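/- For n ≥ 1 let G_n denote the Schreier graph of the free part of the Bernoulli shift of the free group F_n with respect to its standard generating set, and let α_β(G_n) := sup{ β(I) : I ⊆ Free(2^{F_n}) is a β-measurable G_n-independent set }. Then lim_{n→∞} α_β(G_n) · n / log n = 1/2, where log denotes the natural logarithm. In particular, α_β(G_n) = (1/2 + o(1))·(log n)/n. -/

import Mathlib

open MeasureTheory

/-- The Bernoulli shift action of a group `Γ` on `2^Γ = (Γ → Bool)`,
given by `(γ · x) δ = x (δ * γ)`. -/
def bernoulliShift {Γ : Type*} [Group Γ] (γ : Γ) (x : Γ → Bool) : Γ → Bool :=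
  fun δ => x (δ * γ)

/-- The free part `Free(2^Γ)` of the Bernoulli shift: points with trivial stabilizer. -/
def freePart (Γ : Type*) [Group Γ] : Set (Γ → Bool) :=
  {x | ∀ γ : Γ, γ ≠ 1 → bernoulliShift γ x ≠ x}

/-- `β` is the product of countably many copies of the uniform measure on `{0,1}`:
it gives each cylinder determined by finitely many coordinates its natural measure. -/
def IsBernoulliMeasure {Γ : Type*} [Group Γ] (β : Measure (Γ → Bool)) : Prop :=
  ∀ (D : Finset Γ) (φ : Γ → Bool),
    β {x | ∀ δ ∈ D, x δ = φ δ} = (1 / 2 : ENNReal) ^ D.card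

/-- Adjacency in the Schreier graph of the free part of the Bernoulli shift with
respect to a finite set `F`: distinct free points `x, y` with `y = σ · x` for some
`σ ∈ F ∪ F⁻¹`. -/
def schreierAdj {Γ : Type*} [Group Γ] (F : Finset Γ) (x y : Γ → Bool) : Prop :=
  x ∈ freePart Γ ∧ y ∈ freePart Γ ∧ x ≠ y ∧
    ∃ σ : Γ, (σ ∈ F ∨ σ⁻¹ ∈ F) ∧ y = bernoulliShift σ x

/-- A set of vertices is independent w.r.t. an adjacency relation if no two of its
elements are adjacent. -/
def IndepIn {V : Type*} (Adj : V → V → Prop) (I : Set V) : Prop :=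
  ∀ x ∈ I, ∀ y ∈ I, ¬ Adj x y

/-- Adjacency in the Schreier graph `G_n` of the free part of the Bernoulli shift of the
free group `F_n` w.r.t. its standard generating set. -/
def freeGroupSchreierAdj (n : ℕ) (x y : FreeGroup (Fin n) → Bool) : Prop :=
  x ∈ freePart (FreeGroup (Fin n)) ∧ y ∈ freePart (FreeGroup (Fin n)) ∧ x ≠ y ∧
    ∃ i : Fin n, y = bernoulliShift (FreeGroup.of i) x ∨
      y = bernoulliShift (FreeGroup.of i)⁻¹ x


set_option linter.unusedSectionVars false
section Entropy
variable {Ω : Type*} [MeasurableSpace Ω]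

def FM {S : Type*} (X : Ω → S) : Prop := ∀ s, MeasurableSet (X ⁻¹' {s})

noncomputable def rvEnt {S : Type*} [Fintype S] (μ : Measure Ω) (X : Ω → S) : ℝ :=
  ∑ s, Real.negMulLog (μ.real (X ⁻¹' {s}))

theorem FM.pair {S T : Type*} {X : Ω → S} {Y : Ω → T} (hX : FM X) (hY : FM Y) :
    FM (fun ω => (X ω, Y ω)) := by
  rintro ⟨s, t⟩
  have : (fun ω => (X ω, Y ω)) ⁻¹' {(s, t)} = X ⁻¹' {s} ∩ Y ⁻¹' {t} := by
    ext ω; simp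
  rw [this]
  exact (hX s).inter (hY t)

theorem FM.comp_eq {S T : Type*} {X : Ω → S} (f : S → T) (t : T) :
    (f ∘ X) ⁻¹' {t} = ⋃ s ∈ {s | f s = t}, X ⁻¹' {s} := by
  ext ω; simp

theorem FM.comp {S T : Type*} [Finite S] {X : Ω → S} (hX : FM X) (f : S → T) : FM (f ∘ X) := by
  intro t
  rw [FM.comp_eq]
  exact MeasurableSet.biUnion (Set.to_countable _) (fun s _ => hX s)

theorem FM.det {S T : Type*} [Finite S] [Nonempty T] {X : Ω → S} {Y : Ω → T} (hX : FM X)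
    (h : Function.FactorsThrough Y X) : FM Y := by
  obtain ⟨e, rfl⟩ := (Function.factorsThrough_iff Y).1 h
  exact hX.comp e

theorem FM.preimage {S : Type*} {X : Ω → S} (hX : FM X) {T : Ω → Ω} (hT : Measurable T) :
    FM (X ∘ T) := fun s => by
  rw [Set.preimage_comp]; exact hT (hX s)

variable {μ : Measure Ω} [IsProbabilityMeasure μ]

theorem real_comp {S T : Type*} [Fintype S] [DecidableEq T] {X : Ω → S} (hX : FM X)
    (f : S → T) (t : T) :
    μ.real ((f ∘ X) ⁻¹' {t}) = ∑ s, if f s = t then μ.real (X ⁻¹' {s}) else 0 := by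
  classical
  rw [← Finset.sum_filter]
  have : (f ∘ X) ⁻¹' {t} = ⋃ s ∈ Finset.univ.filter (fun s => f s = t), X ⁻¹' {s} := by
    ext ω; simp
  rw [this, measureReal_biUnion_finset]
  · intro a _ b _ hab
    refine Set.disjoint_left.2 ?_
    rintro ω ha hb
    simp only [Set.mem_preimage, Set.mem_singleton_iff] at ha hb
    exact hab (ha.symm.trans hb)
  · intro s _; exact hX s

theorem sum_real {S : Type*} [Fintype S] {X : Ω → S} (hX : FM X) :
    ∑ s, μ.real (X ⁻¹' {s}) = 1 := by
  have := real_comp (μ := μ) hX (fun _ => ()) ()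
  simp only [if_true] at this
  rw [← this]
  have h2 : ((fun _ => ()) ∘ X) ⁻¹' {()} = Set.univ := by ext; simp
  rw [h2]; simp

theorem rvEnt_comp {S T : Type*} [Fintype S] [Fintype T] {X : Ω → S} (hX : FM X) (f : S → T) :
    rvEnt μ (f ∘ X) = ∑ s, μ.real (X ⁻¹' {s}) * (- Real.log (μ.real ((f ∘ X) ⁻¹' {f s}))) := by
  classical
  unfold rvEnt
  have : ∀ t, Real.negMulLog (μ.real ((f ∘ X) ⁻¹' {t})) =
      ∑ s, if f s = t then μ.real (X ⁻¹' {s}) * (- Real.log (μ.real ((f ∘ X) ⁻¹' {f s}))) else 0 := by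
    intro t
    rw [Real.negMulLog]
    conv_lhs => rw [neg_mul, ← mul_neg]
    conv_lhs => lhs; rw [real_comp hX]
    rw [Finset.sum_mul]
    refine Finset.sum_congr rfl fun s _ => ?_
    split_ifs with h
    · rw [h]
    · simp
  simp_rw [this]
  rw [Finset.sum_comm]
  simp

theorem real_le_comp {S T : Type*} {X : Ω → S} (f : S → T) (s : S) :
    μ.real (X ⁻¹' {s}) ≤ μ.real ((f ∘ X) ⁻¹' {f s}) := by
  apply measureReal_mono _ (measure_ne_top _ _)
  intro ω h
  simp only [Set.mem_preimage, Set.mem_singleton_iff, Function.comp] at *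
  rw [h]

theorem rvEnt_comp_le {S T : Type*} [Fintype S] [Fintype T] {X : Ω → S} (hX : FM X) (f : S → T) :
    rvEnt μ (f ∘ X) ≤ rvEnt μ X := by
  rw [rvEnt_comp hX f, rvEnt]
  refine Finset.sum_le_sum fun s _ => ?_
  rw [Real.negMulLog, neg_mul, ← mul_neg]
  rcases eq_or_lt_of_le (measureReal_nonneg (μ := μ) (s := X ⁻¹' {s})) with h | h
  · rw [← h]; simp
  · apply mul_le_mul_of_nonneg_left _ h.le
    exact neg_le_neg (Real.log_le_log h (real_le_comp f s))

theorem rvEnt_det_le {S T : Type*} [Fintype S] [Fintype T] {X : Ω → S} {Y : Ω → T}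
    (hX : FM X) (h : Function.FactorsThrough Y X) :
    rvEnt μ Y ≤ rvEnt μ X := by
  have : Nonempty Ω := by
    by_contra hne
    rw [not_nonempty_iff] at hne
    exact IsProbabilityMeasure.ne_zero μ (Measure.eq_zero_of_isEmpty μ)
  have : Nonempty T := this.map Y
  obtain ⟨e, rfl⟩ := (Function.factorsThrough_iff Y).1 h
  exact rvEnt_comp_le hX e

theorem rvEnt_submod0 {A B C : Type*} [Fintype A] [Fintype B] [Fintype C]
    {X : Ω → A} {Y : Ω → B} {Z : Ω → C} (hX : FM X) (hY : FM Y) (hZ : FM Z) :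
    rvEnt μ (fun ω => (X ω, Y ω, Z ω)) + rvEnt μ Z ≤
      rvEnt μ (fun ω => (X ω, Z ω)) + rvEnt μ (fun ω => (Y ω, Z ω)) := by
  classical
  set W : Ω → A × B × C := fun ω => (X ω, Y ω, Z ω) with hW
  have mW : FM W := hX.pair (hY.pair hZ)
  let f1 : A × B × C → A × C := fun s => (s.1, s.2.2)
  let f2 : A × B × C → B × C := fun s => s.2
  let f3 : A × B × C → C := fun s => s.2.2
  have e1 : (fun ω => (X ω, Z ω)) = f1 ∘ W := rfl
  have e2 : (fun ω => (Y ω, Z ω)) = f2 ∘ W := rfl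
  have e3 : Z = f3 ∘ W := rfl
  have e0 : rvEnt μ W = ∑ s, μ.real (W ⁻¹' {s}) * (- Real.log (μ.real (W ⁻¹' {s}))) := by
    unfold rvEnt
    refine Finset.sum_congr rfl fun s _ => ?_
    rw [Real.negMulLog]; ring
  have h1 := rvEnt_comp (μ := μ) mW f1
  have h2 := rvEnt_comp (μ := μ) mW f2
  have h3 := rvEnt_comp (μ := μ) mW f3
  rw [e1, e2]
  rw [show rvEnt μ Z = rvEnt μ (f3 ∘ W) from rfl]
  rw [e0, h1, h2, h3, ← sub_nonneg]
  rw [← Finset.sum_add_distrib, ← Finset.sum_add_distrib, ← Finset.sum_sub_distrib]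
  set p : A × B × C → ℝ := fun s => μ.real (W ⁻¹' {s}) with hp
  set p1 : A × C → ℝ := fun s => μ.real ((f1 ∘ W) ⁻¹' {s}) with hp1
  set p2 : B × C → ℝ := fun s => μ.real ((f2 ∘ W) ⁻¹' {s}) with hp2
  set p3 : C → ℝ := fun s => μ.real ((f3 ∘ W) ⁻¹' {s}) with hp3
  have key : ∀ s : A × B × C, p s - p1 (f1 s) * p2 (f2 s) / p3 (f3 s) ≤
     p s * (- Real.log (p1 (f1 s))) + p s * (- Real.log (p2 (f2 s)))
      - (p s * (- Real.log (p s)) + p s * (- Real.log (p3 (f3 s)))) := by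
    intro s
    have n0 : 0 ≤ p s := measureReal_nonneg
    have n1 : p s ≤ p1 (f1 s) := real_le_comp f1 s
    have n2 : p s ≤ p2 (f2 s) := real_le_comp f2 s
    have n3 : p s ≤ p3 (f3 s) := real_le_comp f3 s
    rcases eq_or_lt_of_le n0 with h | h
    · rw [← h] at n1 n2 n3 ⊢
      have : 0 ≤ p1 (f1 s) * p2 (f2 s) / p3 (f3 s) := by positivity
      simp; exact this
    · have q1 := h.trans_le n1
      have q2 := h.trans_le n2
      have q3 := h.trans_le n3
      have := Real.log_le_sub_one_of_pos (x := p1 (f1 s) * p2 (f2 s) / p3 (f3 s) / p s) (by positivity)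
      rw [Real.log_div (by positivity) (by positivity), Real.log_div (by positivity) (by positivity),
        Real.log_mul (by positivity) (by positivity)] at this
      have h4 := mul_le_mul_of_nonneg_left this h.le
      have h5 : p s * (p1 (f1 s) * p2 (f2 s) / p3 (f3 s) / p s - 1) =
        p1 (f1 s) * p2 (f2 s) / p3 (f3 s) - p s := by field_simp
      rw [h5] at h4
      linarith
  refine le_trans ?_ (Finset.sum_le_sum fun s _ => key s)
  rw [Finset.sum_sub_distrib]
  have hs1 : ∑ s, p s = 1 := sum_real mW
  have m1 : ∀ c, ∑ a, p1 (a, c) = p3 c := by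
    intro c
    have := real_comp (μ := μ) (mW.comp f1) (fun s : A × C => s.2) c
    rw [show p3 c = _ from this, Fintype.sum_prod_type]
    simp [hp1]
  have m2 : ∀ c, ∑ a, p2 (a, c) = p3 c := by
    intro c
    have := real_comp (μ := μ) (mW.comp f2) (fun s : B × C => s.2) c
    rw [show p3 c = _ from this, Fintype.sum_prod_type]
    simp [hp2]
  have m3 : ∑ c, p3 c = 1 := sum_real (mW.comp f3)
  have : ∑ s : A × B × C, p1 (f1 s) * p2 (f2 s) / p3 (f3 s) = ∑ c, p3 c := by
    rw [Fintype.sum_prod_type]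
    simp_rw [Fintype.sum_prod_type]
    simp only [f1, f2, f3]
    calc _ = ∑ c, ∑ a, ∑ b, p1 (a, c) * p2 (b, c) / p3 c := by
          rw [Finset.sum_comm]
          simp_rw [fun b => Finset.sum_comm (s := (Finset.univ : Finset A)) (t := (Finset.univ : Finset C))
            (f := fun a c => p1 (a, c) * p2 (b, c) / p3 c)]
          rw [Finset.sum_comm]
          refine Finset.sum_congr rfl fun c _ => ?_
          rw [Finset.sum_comm]
      _ = ∑ c, p3 c := by
          refine Finset.sum_congr rfl fun c _ => ?_
          simp_rw [← Finset.sum_div, ← Finset.mul_sum, ← Finset.sum_mul, m1, m2]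
          exact mul_self_div_self _
  rw [this, hs1, m3]; simp

theorem rvEnt_submod {A B C D : Type*} [Fintype A] [Fintype B] [Fintype C] [Fintype D]
    {U : Ω → D} {V : Ω → A} {W : Ω → B} {Z : Ω → C} (hV : FM V) (hW : FM W) (hZ : FM Z)
    (hU : Function.FactorsThrough U (fun ω => (V ω, W ω)))
    (hZV : Function.FactorsThrough Z V) (hZW : Function.FactorsThrough Z W) :
    rvEnt μ U + rvEnt μ Z ≤ rvEnt μ V + rvEnt μ W := by
  have h := rvEnt_submod0 (μ := μ) hV hW hZ
  have h1 : rvEnt μ U ≤ rvEnt μ (fun ω => (V ω, W ω, Z ω)) := by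
    apply rvEnt_det_le (hV.pair (hW.pair hZ))
    intro a b hab
    simp only [Prod.mk.injEq] at hab
    exact hU (by simp [hab.1, hab.2.1])
  have h2 : rvEnt μ (fun ω => (V ω, Z ω)) ≤ rvEnt μ V := by
    apply rvEnt_det_le hV
    intro a b hab
    simp [hab, hZV hab]
  have h3 : rvEnt μ (fun ω => (W ω, Z ω)) ≤ rvEnt μ W := by
    apply rvEnt_det_le hW
    intro a b hab
    simp [hab, hZW hab]
  linarith

theorem rvEnt_mp {S : Type*} [Fintype S] {X : Ω → S} (hX : FM X) {T : Ω → Ω}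
    (hT : MeasurePreserving T μ μ) : rvEnt μ (X ∘ T) = rvEnt μ X := by
  unfold rvEnt
  refine Finset.sum_congr rfl fun s _ => ?_
  rw [Set.preimage_comp, measureReal_def, hT.measure_preimage (hX s).nullMeasurableSet, measureReal_def]

/-- mutual information lower bound -/
theorem rvEnt_mutual {S : Type*} [Fintype S] {X Y : Ω → S} (hX : FM X) (hY : FM Y)
    (R : S → S → Prop) [∀ s t, Decidable (R s t)] (hR : ∀ ω, ¬ R (X ω) (Y ω))
    (hXY : ∀ s, μ.real (Y ⁻¹' {s}) = μ.real (X ⁻¹' {s})) :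
    ∑ s, ∑ t, (if R s t then μ.real (X ⁻¹' {s}) * μ.real (X ⁻¹' {t}) else 0) ≤
      2 * rvEnt μ X - rvEnt μ (fun ω => (X ω, Y ω)) := by
  classical
  set W : Ω → S × S := fun ω => (X ω, Y ω) with hW
  have mW : FM W := hX.pair hY
  have hYe : rvEnt μ Y = rvEnt μ X := by
    unfold rvEnt; simp_rw [hXY]
  have h1 := rvEnt_comp (μ := μ) mW Prod.fst
  have h2 := rvEnt_comp (μ := μ) mW Prod.snd
  have e1 : Prod.fst ∘ W = X := rfl
  have e2 : Prod.snd ∘ W = Y := rfl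
  have e0 : rvEnt μ W = ∑ s, μ.real (W ⁻¹' {s}) * (- Real.log (μ.real (W ⁻¹' {s}))) := by
    unfold rvEnt
    refine Finset.sum_congr rfl fun s _ => ?_
    rw [Real.negMulLog]; ring
  rw [e1] at h1
  rw [e2, hYe] at h2
  rw [two_mul]
  conv_rhs => rw [e0]; lhs; rw [h1]
  rw [← h1]
  conv_rhs => rw [h1]; lhs; rhs; rw [← h1, h2]
  rw [← Finset.sum_add_distrib, ← Finset.sum_sub_distrib]
  set p : S × S → ℝ := fun s => μ.real (W ⁻¹' {s}) with hp
  set q : S → ℝ := fun s => μ.real (X ⁻¹' {s}) with hq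
  have key : ∀ s : S × S, p s - (if R s.1 s.2 then 0 else q s.1 * q s.2) ≤
     p s * (- Real.log (q s.1)) + p s * (- Real.log (μ.real (Y ⁻¹' {s.2})))
      - (p s * (- Real.log (p s))) := by
    intro s
    rw [hXY]
    have n0 : 0 ≤ p s := measureReal_nonneg
    have n1 : p s ≤ q s.1 := real_le_comp (X := W) Prod.fst s
    have n2 : p s ≤ q s.2 := by
      rw [show q s.2 = _ from (hXY s.2).symm]
      exact real_le_comp (X := W) Prod.snd s
    rcases eq_or_lt_of_le n0 with h | h
    · rw [← h] at n1 n2 ⊢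
      have : 0 ≤ q s.1 * q s.2 := by positivity
      simp only [zero_sub, zero_mul, add_zero, neg_zero]
      split_ifs <;> simp [this]
    · have hnR : ¬ R s.1 s.2 := by
        intro hr
        have : W ⁻¹' {s} = ∅ := by
          ext ω
          simp only [Set.mem_preimage, Set.mem_singleton_iff, Set.mem_empty_iff_false, iff_false]
          intro hh
          apply hR ω
          rw [← hh] at hr
          exact hr
        simp [hp, this] at h
      rw [if_neg hnR]
      have q1 := h.trans_le n1
      have q2 := h.trans_le n2
      have := Real.log_le_sub_one_of_pos (x := q s.1 * q s.2 / p s) (by positivity)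
      rw [Real.log_div (by positivity) (by positivity),
        Real.log_mul (by positivity) (by positivity)] at this
      have h4 := mul_le_mul_of_nonneg_left this h.le
      have h5 : p s * (q s.1 * q s.2 / p s - 1) = q s.1 * q s.2 - p s := by field_simp
      rw [h5] at h4
      change _ ≤ p s * (- Real.log (q s.1)) + p s * (- Real.log (q s.2)) - _
      linarith
  refine le_trans ?_ (Finset.sum_le_sum fun s _ => key s)
  rw [Finset.sum_sub_distrib, show ∑ s, p s = 1 from sum_real mW]
  have hq1 : ∑ s, q s = 1 := sum_real hX
  have : (1 : ℝ) = ∑ s, ∑ t, q s * q t := by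
    simp_rw [← Finset.mul_sum, hq1, mul_one, hq1]
  rw [this, Fintype.sum_prod_type, ← Finset.sum_sub_distrib]
  refine Finset.sum_le_sum fun s _ => ?_
  rw [← Finset.sum_sub_distrib]
  refine Finset.sum_le_sum fun t _ => ?_
  split_ifs <;> simp [hq]

end Entropy


section Finv
variable {Ω : Type*} [MeasurableSpace Ω] {μ : Measure Ω} [IsProbabilityMeasure μ]

noncomputable def Finv {n : ℕ} {S : Type*} [Fintype S] (μ : Measure Ω) (T : Fin n → Ω → Ω)
    (X : Ω → S) : ℝ :=
  (1 - 2 * n) * rvEnt μ X + ∑ i, rvEnt μ (fun ω => (X ω, X (T i ω)))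

theorem Finv_det {n : ℕ} {S S' : Type*} [Fintype S] [Fintype S'] {T : Fin n → Ω → Ω}
    (hT : ∀ i, Measurable (T i))
    {X : Ω → S} {Y : Ω → S'} (hX : FM X) (hY : FM Y)
    (h : Function.FactorsThrough Y X) (h' : Function.FactorsThrough X Y) :
    Finv μ T X = Finv μ T Y := by
  unfold Finv
  rw [le_antisymm (rvEnt_det_le (μ := μ) hX h) (rvEnt_det_le hY h')]
  congr 1
  refine Finset.sum_congr rfl fun i _ => ?_
  apply le_antisymm
  · apply rvEnt_det_le (hY.pair (hY.preimage (hT i)))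
    intro a b hab
    simp only [Prod.mk.injEq, Function.comp] at hab ⊢
    exact ⟨h' hab.1, h' hab.2⟩
  · apply rvEnt_det_le (hX.pair (hX.preimage (hT i)))
    intro a b hab
    simp only [Prod.mk.injEq, Function.comp] at hab ⊢
    exact ⟨h hab.1, h hab.2⟩

theorem Finv_sum_aux {n : ℕ} (j : Fin n) (a b : Fin n → ℝ) (d : ℝ)
    (h : ∀ i, i ≠ j → a i ≤ b i + 2 * d) (hj : a j ≤ b j + d) :
    (∑ i, a i) ≤ (∑ i, b i) + (2 * n - 1) * d := by
  classical
  have h1 : ∑ i, a i ≤ ∑ i, (b i + (if i = j then d else 2 * d)) := by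
    refine Finset.sum_le_sum fun i _ => ?_
    split_ifs with hi
    · rw [hi]; exact hj
    · exact h i hi
  have h2 : ∑ i : Fin n, (if i = j then d else 2 * d) = (2 * n - 1) * d := by
    have : ∀ i : Fin n, (if i = j then d else 2 * d) = 2 * d - (if i = j then d else 0) := by
      intro i; split_ifs <;> ring
    simp_rw [this]
    rw [Finset.sum_sub_distrib]
    simp; ring
  rw [Finset.sum_add_distrib, h2] at h1
  exact h1

variable {n : ℕ} {S S' : Type*} [Fintype S] [Fintype S'] {T Ti : Fin n → Ω → Ω}
    {X : Ω → S} {Y : Ω → S'}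

theorem Finv_split_step {T : Ω → Ω} {X : Ω → S} {X' : Ω → S'}
    (hT : MeasurePreserving T μ μ) (hX : FM X) (hX' : FM X')
    (h : Function.FactorsThrough X X') :
    (rvEnt μ (fun ω => (X' ω, X' (T ω))) ≤ rvEnt μ (fun ω => (X ω, X (T ω)))
      + 2 * (rvEnt μ X' - rvEnt μ X)) ∧
    (rvEnt μ (fun ω => (X ω, X' (T ω))) ≤ rvEnt μ (fun ω => (X ω, X (T ω)))
      + (rvEnt μ X' - rvEnt μ X)) ∧
    (rvEnt μ (fun ω => (X' ω, X (T ω))) ≤ rvEnt μ (fun ω => (X ω, X (T ω)))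
      + (rvEnt μ X' - rvEnt μ X)) := by
  have hXT : FM (X ∘ T) := hX.preimage hT.measurable
  have hXT' : FM (X' ∘ T) := hX'.preimage hT.measurable
  have e1 := rvEnt_mp (μ := μ) hX hT
  have e2 := rvEnt_mp (μ := μ) hX' hT
  have s1 : rvEnt μ (fun ω => (X' ω, X' (T ω))) + rvEnt μ X ≤
      rvEnt μ X' + rvEnt μ (fun ω => (X ω, X' (T ω))) := by
    apply rvEnt_submod hX' (hX.pair hXT') hX
    · intro a b hab
      simp only [Prod.mk.injEq, Function.comp] at hab ⊢
      exact ⟨hab.1, hab.2.2⟩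
    · exact h
    · intro a b hab
      simp only [Prod.mk.injEq, Function.comp] at hab ⊢
      exact hab.1
  have s2 : rvEnt μ (fun ω => (X ω, X' (T ω))) + rvEnt μ (X ∘ T) ≤
      rvEnt μ (X' ∘ T) + rvEnt μ (fun ω => (X ω, X (T ω))) := by
    apply rvEnt_submod hXT' (hX.pair hXT) hXT
    · intro a b hab
      simp only [Prod.mk.injEq, Function.comp] at hab ⊢
      exact ⟨hab.2.1, hab.1⟩
    · intro a b hab
      exact h hab
    · intro a b hab
      simp only [Prod.mk.injEq, Function.comp] at hab ⊢
      exact hab.2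
  have s3 : rvEnt μ (fun ω => (X' ω, X (T ω))) + rvEnt μ X ≤
      rvEnt μ X' + rvEnt μ (fun ω => (X ω, X (T ω))) := by
    apply rvEnt_submod hX' (hX.pair hXT) hX
    · intro a b hab
      simp only [Prod.mk.injEq, Function.comp] at hab ⊢
      exact ⟨hab.1, hab.2.2⟩
    · exact h
    · intro a b hab
      simp only [Prod.mk.injEq, Function.comp] at hab ⊢
      exact hab.1
  refine ⟨?_, ?_, ?_⟩ <;> linarith

theorem Finv_split (hT : ∀ i, MeasurePreserving (T i) μ μ)
    (hX : FM X) (hY : FM Y) (h : Function.FactorsThrough Y X) (j : Fin n) :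
    Finv μ T (fun ω => (X ω, Y (T j ω))) ≤ Finv μ T X := by
  have hYT : FM (Y ∘ T j) := hY.preimage (hT j).measurable
  have hX' : FM (fun ω => (X ω, Y (T j ω))) := hX.pair hYT
  have hd : Function.FactorsThrough X (fun ω => (X ω, Y (T j ω))) := by
    intro a b hab
    simp only [Prod.mk.injEq] at hab
    exact hab.1
  have := Finv_sum_aux j (fun i => rvEnt μ (fun ω => ((X ω, Y (T j ω)), (X (T i ω), Y (T j (T i ω))))))
    (fun i => rvEnt μ (fun ω => (X ω, X (T i ω)))) (rvEnt μ (fun ω => (X ω, Y (T j ω))) - rvEnt μ X)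
    (fun i _ => (Finv_split_step (hT i) hX hX' hd).1)
    (by
      refine le_trans ?_ (Finv_split_step (hT j) hX hX' hd).2.1
      apply rvEnt_det_le (hX.pair (hX'.preimage (hT j).measurable))
      intro a b hab
      simp only [Prod.mk.injEq, Function.comp] at hab ⊢
      exact ⟨⟨hab.1, h hab.2.1⟩, hab.2⟩)
  unfold Finv
  linarith

theorem Finv_split' (hT : ∀ i, MeasurePreserving (T i) μ μ)
    (hTi : ∀ i, MeasurePreserving (Ti i) μ μ) (hinv : ∀ i ω, Ti i (T i ω) = ω)
    (hX : FM X) (hY : FM Y) (h : Function.FactorsThrough Y X) (j : Fin n) :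
    Finv μ T (fun ω => (X ω, Y (Ti j ω))) ≤ Finv μ T X := by
  have hYT : FM (Y ∘ Ti j) := hY.preimage (hTi j).measurable
  have hX' : FM (fun ω => (X ω, Y (Ti j ω))) := hX.pair hYT
  have hd : Function.FactorsThrough X (fun ω => (X ω, Y (Ti j ω))) := by
    intro a b hab
    simp only [Prod.mk.injEq] at hab
    exact hab.1
  have := Finv_sum_aux j (fun i => rvEnt μ (fun ω => ((X ω, Y (Ti j ω)), (X (T i ω), Y (Ti j (T i ω))))))
    (fun i => rvEnt μ (fun ω => (X ω, X (T i ω)))) (rvEnt μ (fun ω => (X ω, Y (Ti j ω))) - rvEnt μ X)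
    (fun i _ => (Finv_split_step (hT i) hX hX' hd).1)
    (by
      refine le_trans ?_ (Finv_split_step (hT j) hX hX' hd).2.2
      apply rvEnt_det_le (hX'.pair (hX.preimage (hT j).measurable))
      intro a b hab
      simp only [Prod.mk.injEq, Function.comp, hinv] at hab ⊢
      exact ⟨hab.1, hab.2, h hab.1.1⟩)
  unfold Finv
  linarith

/-- F(Y, X) ≤ F(X) + H(Y) -/
theorem Finv_pair_le (hT : ∀ i, MeasurePreserving (T i) μ μ)
    (hX : FM X) (hY : FM Y) :
    Finv μ T (fun ω => (Y ω, X ω)) ≤ Finv μ T X + rvEnt μ Y := by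
  have hYX : FM (fun ω => (Y ω, X ω)) := hY.pair hX
  have hd : Function.FactorsThrough X (fun ω => (Y ω, X ω)) := by
    intro a b hab
    simp only [Prod.mk.injEq] at hab
    exact hab.2
  have h1 : ∑ i, rvEnt μ (fun ω => ((Y ω, X ω), (Y (T i ω), X (T i ω)))) ≤
      ∑ i, (rvEnt μ (fun ω => (X ω, X (T i ω))) + 2 * (rvEnt μ (fun ω => (Y ω, X ω)) - rvEnt μ X)) :=
    Finset.sum_le_sum fun i _ => (Finv_split_step (hT i) hX hYX hd).1
  rw [Finset.sum_add_distrib] at h1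
  simp only [Finset.sum_const, Finset.card_univ, Fintype.card_fin, nsmul_eq_mul] at h1
  have h2 : rvEnt μ (fun ω => (Y ω, X ω)) + rvEnt μ (fun _ : Ω => ()) ≤ rvEnt μ Y + rvEnt μ X := by
    apply rvEnt_submod hY hX
    · intro s; simp
    · intro a b hab
      exact hab
    · intro a b hab; rfl
    · intro a b hab; rfl
  have h3 : rvEnt μ (fun _ : Ω => ()) = 0 := by
    simp [rvEnt]
  unfold Finv
  linarith

end Finv

set_option linter.unusedSectionVars false

section FG
variable {n : ℕ}

def ltr (s : Fin n × Bool) : FreeGroup (Fin n) := FreeGroup.mk [s]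
def linv (s : Fin n × Bool) : Fin n × Bool := (s.1, !s.2)

theorem ltr_true (i : Fin n) : ltr (i, true) = FreeGroup.of i := rfl
theorem ltr_linv (s : Fin n × Bool) : ltr (linv s) = (ltr s)⁻¹ := by
  simp [ltr, linv, FreeGroup.invRev]
theorem linv_linv (s : Fin n × Bool) : linv (linv s) = s := by simp [linv]
theorem ltr_false (i : Fin n) : ltr (i, false) = (FreeGroup.of i)⁻¹ := by
  rw [← ltr_true, ← ltr_linv]; rfl

theorem toWord_ltr_mul (s : Fin n × Bool) (g : FreeGroup (Fin n)) :
    (ltr s * g).toWord = List.casesOn g.toWord [s] fun hd tl =>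
        if s.1 = hd.1 ∧ s.2 = not hd.2 then tl else s :: hd :: tl := by
  have : ltr s * g = FreeGroup.mk (s :: g.toWord) := by
    conv_lhs => rw [← FreeGroup.mk_toWord (x := g)]
    rw [ltr, FreeGroup.mul_mk]; rfl
  rw [this, FreeGroup.toWord_mk, FreeGroup.reduce.cons, FreeGroup.reduce_toWord]

theorem norm_ltr_mul (s : Fin n × Bool) (g : FreeGroup (Fin n)) :
    ((ltr s * g).norm = g.norm + 1 ∧ g.toWord.head? ≠ some (linv s)) ∨
    ((ltr s * g).norm + 1 = g.norm ∧ g.toWord.head? = some (linv s)) := by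
  unfold FreeGroup.norm
  rw [toWord_ltr_mul]
  rcases h : g.toWord with _ | ⟨hd, tl⟩
  · left; simp
  · simp only
    split_ifs with h2
    · right
      simp only [List.length_cons, List.head?_cons, Option.some.injEq, true_and]
      apply Prod.ext
      · exact h2.1.symm
      · simp [linv, h2.2]
    · left
      simp only [List.length_cons, List.head?_cons, Option.some.injEq, true_and, ne_eq]
      intro h3
      apply h2
      rw [h3]; simp [linv]

theorem norm_mul_ltr (g : FreeGroup (Fin n)) (s : Fin n × Bool) :
    (g * ltr s).norm = (ltr (linv s) * g⁻¹).norm := by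
  rw [← FreeGroup.norm_inv_eq, mul_inv_rev, ltr_linv]

theorem norm_mul_ltr_cases (g : FreeGroup (Fin n)) (s : Fin n × Bool) :
    (g * ltr s).norm = g.norm + 1 ∨ (g * ltr s).norm + 1 = g.norm := by
  rw [norm_mul_ltr, ← FreeGroup.norm_inv_eq (x := g)]
  rcases norm_ltr_mul (linv s) g⁻¹ with h | h
  · left; exact h.1
  · right; exact h.1

theorem norm_mul_ltr_unique {g : FreeGroup (Fin n)} {s s' : Fin n × Bool}
    (h : (g * ltr s).norm < g.norm) (h' : (g * ltr s').norm < g.norm) : s = s' := by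
  rw [norm_mul_ltr, ← FreeGroup.norm_inv_eq (x := g)] at h h'
  rcases norm_ltr_mul (linv s) g⁻¹ with h1 | h1
  · omega
  rcases norm_ltr_mul (linv s') g⁻¹ with h2 | h2
  · omega
  have := h1.2.symm.trans h2.2
  simpa [linv_linv] using this

theorem edge_count (B : Finset (FreeGroup (Fin n))) (hB : B.Nonempty) :
    ∑ i : Fin n, (B ∩ B.image (fun b => b * FreeGroup.of i)).card + 1 ≤ B.card := by
  classical
  -- general bound: edges inject in `B` minus a norm minimal element
  obtain ⟨m, hm, hmin⟩ := B.exists_min_image FreeGroup.norm hB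
  have hcard : (B.erase m).card + 1 = B.card := Finset.card_erase_add_one hm
  rw [← hcard, add_le_add_iff_right, ← Finset.card_sigma]
  apply Finset.card_le_card_of_injOn
    (fun e => if (e.2 * ltr (e.1, false)).norm < e.2.norm then e.2 else e.2 * ltr (e.1, false))
  · rintro ⟨i, c⟩ h
    simp only [Finset.mem_coe, Finset.mem_sigma, Finset.mem_univ, true_and, Finset.mem_inter,
      Finset.mem_image] at h
    obtain ⟨hc, b, hb, hbc⟩ := h
    have hb' : c * ltr (i, false) = b := by rw [← hbc, ltr_false]; group
    simp only [Finset.mem_coe, Finset.mem_erase]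
    have h1 := hmin c hc
    have h2 := hmin b hb
    rcases norm_mul_ltr_cases c (i, false) with h | h
    · rw [if_neg (by omega)]
      rw [hb'] at h ⊢
      refine ⟨?_, hb⟩
      rintro rfl
      omega
    · rw [if_pos (by omega)]
      rw [hb'] at h
      refine ⟨?_, hc⟩
      rintro rfl
      omega
  · have key : ∀ e : (Σ _ : Fin n, FreeGroup (Fin n)), ∃ s : Fin n × Bool,
        (((if (e.2 * ltr (e.1, false)).norm < e.2.norm then e.2 else e.2 * ltr (e.1, false)) * ltr s).norm
        < (if (e.2 * ltr (e.1, false)).norm < e.2.norm then e.2 else e.2 * ltr (e.1, false)).norm) ∧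
        e = ⟨s.1, if s.2 then (if (e.2 * ltr (e.1, false)).norm < e.2.norm then e.2 else e.2 * ltr (e.1, false)) * ltr s
          else (if (e.2 * ltr (e.1, false)).norm < e.2.norm then e.2 else e.2 * ltr (e.1, false))⟩ := by
      rintro ⟨i, c⟩
      simp only
      rcases norm_mul_ltr_cases c (i, false) with h | h
      · rw [if_neg (by omega)]
        refine ⟨(i, true), ?_, ?_⟩
        · rw [ltr_true, ltr_false, inv_mul_cancel_right]
          rw [ltr_false] at h
          omega
        · simp [ltr_true, ltr_false]
      · rw [if_pos (by omega)]
        exact ⟨(i, false), by omega, by simp⟩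
    intro e _ e' _ hee
    simp only at hee
    obtain ⟨s, h1, h2⟩ := key e
    obtain ⟨s', h1', h2'⟩ := key e'
    rw [← hee] at h1' h2'
    have := norm_mul_ltr_unique h1 h1'
    subst this
    rw [h2, h2']
end FG

section Prod
variable {n : ℕ} {A : Type*} [Fintype A] [MeasurableSpace A] [MeasurableSingletonClass A]
  (ν : Measure A) [IsProbabilityMeasure ν]

def sh {Γ A : Type*} [Group Γ] (γ : Γ) (x : Γ → A) : Γ → A := fun δ => x (δ * γ)

theorem sh_sh {Γ A : Type*} [Group Γ] (γ γ' : Γ) (x : Γ → A) : sh γ (sh γ' x) = sh (γ * γ') x := by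
  funext δ; simp [sh, mul_assoc]

theorem sh_mp {Γ : Type*} [Group Γ] (γ : Γ) : MeasurePreserving (sh γ)
    (Measure.infinitePi (fun _ : Γ => ν)) (Measure.infinitePi (fun _ : Γ => ν)) := by
  refine ⟨by unfold sh; fun_prop, ?_⟩
  exact Measure.map_infinitePi_infinitePi_of_inj (P := fun _ : Γ => ν) (f := fun δ : Γ => δ * γ)
    (mul_left_injective γ)

theorem infPi_box {Γ : Type*} (D : Finset Γ) (φ : Γ → A) :
    (Measure.infinitePi (fun _ : Γ => ν)).real {x | ∀ δ ∈ D, x δ = φ δ} =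
      ∏ δ ∈ D, ν.real {φ δ} := by
  have : {x : Γ → A | ∀ δ ∈ D, x δ = φ δ} = Set.pi D (fun δ => {φ δ}) := by
    ext; simp [Set.pi]
  rw [this, measureReal_def, Measure.infinitePi_pi]
  · simp [measureReal_def, ENNReal.toReal_prod]
  · intro i _; exact measurableSet_singleton _

def rst {Γ A : Type*} (B : Finset Γ) (x : Γ → A) : B → A := fun b => x b

theorem FM_of_measurable {Ω S : Type*} [MeasurableSpace Ω] [MeasurableSpace S]
    [MeasurableSingletonClass S] {X : Ω → S} (h : Measurable X) : FM X :=
  fun s => h (measurableSet_singleton s)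

theorem FM_rst {Γ : Type*} (B : Finset Γ) : FM (rst (A := A) B) :=
  FM_of_measurable (by unfold rst; fun_prop)

theorem rst_det {Γ A : Type*} {B C : Finset Γ} (h : B ⊆ C) :
    Function.FactorsThrough (rst (A := A) B) (rst C) := by
  intro x y hxy
  funext b
  exact congrFun hxy ⟨b, h b.2⟩

theorem rvEnt_indep {Ω S T : Type*} [MeasurableSpace Ω] {μ : Measure Ω} [IsProbabilityMeasure μ]
    [Fintype S] [Fintype T]
    {X : Ω → S} {Y : Ω → T} (hX : FM X) (hY : FM Y)
    (h : ∀ s t, μ.real ((fun ω => (X ω, Y ω)) ⁻¹' {(s, t)}) =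
      μ.real (X ⁻¹' {s}) * μ.real (Y ⁻¹' {t})) :
    rvEnt μ (fun ω => (X ω, Y ω)) = rvEnt μ X + rvEnt μ Y := by
  unfold rvEnt
  rw [Fintype.sum_prod_type]
  simp_rw [h, Real.negMulLog_mul, Finset.sum_add_distrib, ← Finset.mul_sum, ← Finset.sum_mul]
  rw [sum_real hX, sum_real hY]; simp

noncomputable def baseEnt (ν : Measure A) : ℝ := ∑ a, Real.negMulLog (ν.real {a})

theorem baseEnt_nonneg : 0 ≤ baseEnt ν :=
  Finset.sum_nonneg fun a _ => Real.negMulLog_nonneg measureReal_nonneg measureReal_le_one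

theorem rst_fiber {Γ : Type*} (B : Finset Γ) (φ : B → A) (φ' : Γ → A) (h : ∀ b : B, φ' b = φ b) :
    rst B ⁻¹' {φ} = {x | ∀ δ ∈ B, x δ = φ' δ} := by
  ext x
  simp only [Set.mem_preimage, Set.mem_singleton_iff, Set.mem_ofPred_eq]
  constructor
  · rintro rfl δ hδ; exact (h ⟨δ, hδ⟩).symm
  · intro hx; funext b; rw [← h b]; exact hx b b.2

theorem rst_real {Γ : Type*} (B : Finset Γ) (φ : B → A) :
    (Measure.infinitePi (fun _ : Γ => ν)).real (rst B ⁻¹' {φ}) = ∏ b : B, ν.real {φ b} := by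
  classical
  by_cases hA : Nonempty A
  · obtain ⟨a⟩ := hA
    rw [rst_fiber B φ (fun γ => if h : γ ∈ B then φ ⟨γ, h⟩ else a) (by simp), infPi_box]
    rw [← Finset.prod_coe_sort]
    refine Finset.prod_congr rfl fun b _ => ?_
    simp
  · rw [not_nonempty_iff] at hA
    exact absurd (Measure.eq_zero_of_isEmpty ν) (IsProbabilityMeasure.ne_zero ν)

theorem rvEnt_rst {Γ : Type*} [DecidableEq Γ] (B : Finset Γ) :
    rvEnt (Measure.infinitePi (fun _ : Γ => ν)) (rst B) = B.card * baseEnt ν := by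
  classical
  induction B using Finset.induction_on with
  | empty =>
    unfold rvEnt
    simp [rst_real]
  | insert c B hc ih =>
    have h1 : rvEnt (Measure.infinitePi (fun _ : Γ => ν)) (rst (insert c B)) =
        rvEnt (Measure.infinitePi (fun _ : Γ => ν)) (fun x => (rst B x, x c)) := by
      have mc : FM (fun x : Γ → A => x c) := FM_of_measurable (by fun_prop)
      apply le_antisymm
      · apply rvEnt_det_le ((FM_rst B).pair mc)
        intro x y hxy
        simp only [Prod.mk.injEq] at hxy
        funext b
        rcases Finset.mem_insert.1 b.2 with hb | hb
        · simp only [rst, hb]; exact hxy.2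
        · exact congrFun hxy.1 ⟨b, hb⟩
      · apply rvEnt_det_le (FM_rst _)
        intro x y hxy
        simp only [Prod.mk.injEq]
        exact ⟨rst_det (Finset.subset_insert c B) hxy,
          congrFun hxy ⟨c, Finset.mem_insert_self c B⟩⟩
    have hc1 : ∀ a, (Measure.infinitePi (fun _ : Γ => ν)).real ((fun x : Γ → A => x c) ⁻¹' {a}) = ν.real {a} := by
      intro a
      have := infPi_box ν {c} (fun _ => a)
      simp only [Finset.mem_singleton, forall_eq, Finset.prod_singleton] at this
      exact this
    rw [h1, rvEnt_indep (FM_rst B) (FM_of_measurable (by fun_prop)), ih, Finset.card_insert_of_notMem hc]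
    · rw [show rvEnt (Measure.infinitePi (fun _ : Γ => ν)) (fun x => x c) = baseEnt ν by
        unfold rvEnt baseEnt; simp_rw [hc1]]
      push_cast; ring
    · intro φ a
      rw [hc1]
      have e2 : (fun x => (rst B x, x c)) ⁻¹' {(φ, a)} =
        {x : Γ → A | ∀ δ ∈ insert c B, x δ = if h : δ ∈ B then φ ⟨δ, h⟩ else a} := by
        ext x
        simp only [Set.mem_preimage, Set.mem_singleton_iff, Prod.mk.injEq, Set.mem_ofPred_eq,
          Finset.forall_mem_insert, hc, dif_neg, not_false_eq_true]
        rw [and_comm]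
        refine and_congr_right fun _ => ?_
        constructor
        · rintro rfl δ hδ; simp [hδ, rst]
        · intro hx; funext b
          have := hx b b.2
          simpa [rst] using this
      rw [e2, infPi_box, Finset.prod_insert hc, rst_real, mul_comm]
      congr 1
      · rw [← Finset.prod_coe_sort]
        refine Finset.prod_congr rfl fun b _ => ?_
        simp
      · simp [hc]

noncomputable def gens (n : ℕ) {A : Type*} : Fin n → (FreeGroup (Fin n) → A) → (FreeGroup (Fin n) → A) :=
  fun i => sh (FreeGroup.of i)

theorem Finv_rst (B : Finset (FreeGroup (Fin n))) (hB : B.Nonempty) :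
    baseEnt ν ≤ Finv (Measure.infinitePi (fun _ : FreeGroup (Fin n) => ν)) (gens n) (rst B) := by
  classical
  unfold Finv
  have h1 : ∀ i : Fin n, rvEnt (Measure.infinitePi (fun _ : FreeGroup (Fin n) => ν))
      (fun x => (rst B x, rst B (gens n i x))) =
      (2 * B.card - (B ∩ B.image (fun b => b * FreeGroup.of i)).card) * baseEnt ν := by
    intro i
    have : rvEnt (Measure.infinitePi (fun _ : FreeGroup (Fin n) => ν))
      (fun x => (rst B x, rst B (gens n i x))) =
      rvEnt (Measure.infinitePi (fun _ : FreeGroup (Fin n) => ν))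
       (rst (B ∪ B.image (fun b => b * FreeGroup.of i))) := by
      apply le_antisymm
      · apply rvEnt_det_le (FM_rst _)
        intro x y hxy
        simp only [Prod.mk.injEq]
        refine ⟨rst_det Finset.subset_union_left hxy, ?_⟩
        funext b
        exact congrFun hxy ⟨b * FreeGroup.of i, Finset.mem_union_right _
          (Finset.mem_image_of_mem _ b.2)⟩
      · apply rvEnt_det_le ((FM_rst _).pair ((FM_rst _).preimage (sh_mp ν _).measurable))
        intro x y hxy
        simp only [Prod.mk.injEq] at hxy
        funext ⟨b, hb⟩
        rcases Finset.mem_union.1 hb with hb | hb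
        · exact congrFun hxy.1 ⟨b, hb⟩
        · obtain ⟨c, hc, rfl⟩ := Finset.mem_image.1 hb
          exact congrFun hxy.2 ⟨c, hc⟩
    rw [this, rvEnt_rst]
    congr 1
    have h2 := Finset.card_union_add_card_inter B (B.image (fun b => b * FreeGroup.of i))
    rw [Finset.card_image_of_injective _ (mul_left_injective (FreeGroup.of i))] at h2
    have h3 : ((B ∪ B.image (fun b => b * FreeGroup.of i)).card : ℝ) +
      (B ∩ B.image (fun b => b * FreeGroup.of i)).card = B.card + B.card := by exact_mod_cast h2
    linarith
  simp_rw [h1, rvEnt_rst]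
  rw [← Finset.sum_mul, Finset.sum_sub_distrib]
  have h4 : (∑ i : Fin n, ((B ∩ B.image (fun b => b * FreeGroup.of i)).card : ℝ)) + 1 ≤ B.card := by
    exact_mod_cast edge_count B hB
  simp only [Finset.sum_const, Finset.card_univ, Fintype.card_fin, nsmul_eq_mul]
  have h5 := baseEnt_nonneg ν
  nlinarith

theorem Finv_nonneg {S : Type*} [Fintype S] {X : (FreeGroup (Fin n) → A) → S}
    (D : Finset (FreeGroup (Fin n))) (hX : FM X) (hD : Function.FactorsThrough X (rst D)) :
    0 ≤ Finv (Measure.infinitePi (fun _ : FreeGroup (Fin n) => ν)) (gens n) X := by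
  classical
  set μ := Measure.infinitePi (fun _ : FreeGroup (Fin n) => ν) with hμ
  let P : Finset (FreeGroup (Fin n)) → Prop := fun B =>
    Finv μ (gens n) (fun x => (rst B x, X x)) ≤ Finv μ (gens n) (fun x => (rst {1} x, X x))
  have hT : ∀ i, MeasurePreserving (gens n i) μ μ := fun i => sh_mp ν _
  have hTi : ∀ i : Fin n, MeasurePreserving (sh (FreeGroup.of i)⁻¹) μ μ := fun i => sh_mp ν _
  have aux : ∀ (B : Finset (FreeGroup (Fin n))) (g : FreeGroup (Fin n)),
      Finv μ (gens n) (fun x => (rst (B ∪ B.image (fun b => b * g)) x, X x)) =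
      Finv μ (gens n) (fun x => ((rst B x, X x), rst B (sh g x))) := by
    intro B g
    have hg : MeasurePreserving (sh g) μ μ := sh_mp ν g
    apply Finv_det (fun i => (hT i).measurable) ((FM_rst _).pair hX)
      (((FM_rst _).pair hX).pair ((FM_rst _).preimage hg.measurable))
    · intro x y hxy
      simp only [Prod.mk.injEq] at hxy ⊢
      refine ⟨⟨rst_det Finset.subset_union_left hxy.1, hxy.2⟩, ?_⟩
      funext b
      exact congrFun hxy.1 ⟨b * g, Finset.mem_union_right _ (Finset.mem_image_of_mem _ b.2)⟩
    · intro x y hxy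
      simp only [Prod.mk.injEq] at hxy ⊢
      refine ⟨?_, hxy.1.2⟩
      funext ⟨b, hb⟩
      rcases Finset.mem_union.1 hb with hb | hb
      · exact congrFun hxy.1.1 ⟨b, hb⟩
      · obtain ⟨c, hc, rfl⟩ := Finset.mem_image.1 hb
        exact congrFun hxy.2 ⟨c, hc⟩
  have hdet : ∀ B : Finset (FreeGroup (Fin n)), Function.FactorsThrough (rst B) (fun x => (rst B x, X x)) := by
    intro B x y hxy
    simp only [Prod.mk.injEq] at hxy
    exact hxy.1
  have step : ∀ B i, P B → P (B ∪ B.image (fun b => b * FreeGroup.of i)) := by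
    intro B i h
    refine le_trans ?_ h
    rw [aux]
    exact Finv_split hT ((FM_rst _).pair hX) (FM_rst B) (hdet B) i
  have step' : ∀ B i, P B → P (B ∪ B.image (fun b => b * (FreeGroup.of i)⁻¹)) := by
    intro B i h
    refine le_trans ?_ h
    rw [aux]
    refine Finv_split' (Ti := fun i => sh (FreeGroup.of i)⁻¹) hT hTi ?_ ((FM_rst _).pair hX) (FM_rst B) (hdet B) i
    intro i x
    simp only [gens]
    rw [sh_sh]; funext δ; simp [sh]
  have grow : ∀ g : FreeGroup (Fin n), ∀ B h, P B → h ∈ B → ∃ B', B ⊆ B' ∧ P B' ∧ h * g ∈ B' := by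
    intro g
    induction g using FreeGroup.induction_on with
    | C1 => intro B h hP hB; exact ⟨B, subset_rfl, hP, by simpa using hB⟩
    | of i => intro B h hP hB
              exact ⟨_, Finset.subset_union_left, step B i hP,
                Finset.mem_union_right _ (Finset.mem_image_of_mem _ hB)⟩
    | inv_of i _ => intro B h hP hB
                    exact ⟨_, Finset.subset_union_left, step' B i hP,
                      Finset.mem_union_right _ (Finset.mem_image_of_mem _ hB)⟩
    | mul a b iha ihb =>
      intro B h hP hB
      obtain ⟨B1, h1, h2, h3⟩ := iha B h hP hB
      obtain ⟨B2, h4, h5, h6⟩ := ihb B1 _ h2 h3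
      exact ⟨B2, h1.trans h4, h5, by rwa [← mul_assoc]⟩
  have exB : ∀ D : Finset (FreeGroup (Fin n)), ∃ B, D ⊆ B ∧ 1 ∈ B ∧ P B := by
    intro D
    induction D using Finset.induction_on with
    | empty => exact ⟨{1}, by simp, by simp, le_rfl⟩
    | insert c D _ ih =>
      obtain ⟨B, h1, h2, h3⟩ := ih
      obtain ⟨B', h4, h5, h6⟩ := grow c B 1 h3 h2
      refine ⟨B', ?_, h4 h2, h5⟩
      rw [Finset.insert_subset_iff]
      exact ⟨by simpa using h6, h1.trans h4⟩
  obtain ⟨B, hDB, h1B, hPB⟩ := exB D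
  have e1 : Finv μ (gens n) (fun x => (rst B x, X x)) = Finv μ (gens n) (rst B) := by
    apply Finv_det (fun i => (hT i).measurable) ((FM_rst _).pair hX) (FM_rst _) (hdet B)
    intro x y hxy
    simp only [Prod.mk.injEq]
    exact ⟨hxy, hD (rst_det hDB hxy)⟩
  have e2 := Finv_rst ν B ⟨1, h1B⟩
  have e3 := Finv_pair_le (Y := rst {1}) hT hX (FM_rst _)
  have e4 := rvEnt_rst ν ({1} : Finset (FreeGroup (Fin n)))
  simp only [Finset.card_singleton, Nat.cast_one, one_mul] at e4
  have e5 : P B := hPB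
  simp only [P] at e5
  linarith

end Prod

set_option linter.unusedSectionVars false

theorem exists_measure_weights {A : Type*} [Fintype A] [MeasurableSpace A] [MeasurableSingletonClass A]
    (w : A → ℝ) (h0 : ∀ a, 0 ≤ w a) (h1 : ∑ a, w a = 1) :
    ∃ ν : Measure A, IsProbabilityMeasure ν ∧ ∀ a, ν.real {a} = w a := by
  classical
  let p : PMF A := PMF.ofFintype (fun a => ENNReal.ofReal (w a)) (by
    rw [← ENNReal.ofReal_sum_of_nonneg (fun a _ => h0 a), h1, ENNReal.ofReal_one])
  refine ⟨p.toMeasure, inferInstance, fun a => ?_⟩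
  rw [measureReal_def, PMF.toMeasure_apply_singleton _ _ (measurableSet_singleton a)]
  simp [p, h0 a]

/-- The basic entropy inequality. -/
theorem ent_ineq {n : ℕ} {A : Type*} [Fintype A] [MeasurableSpace A] [MeasurableSingletonClass A]
    (ν : Measure A) [IsProbabilityMeasure ν] {S : Type*} [Fintype S]
    (B : Finset (FreeGroup (Fin n))) (F : (B → A) → S)
    (R : S → S → Prop) [∀ s t, Decidable (R s t)]
    (hR : ∀ (i : Fin n) (x : FreeGroup (Fin n) → A), ¬ R (F (rst B x)) (F (rst B (gens n i x))))
    (π : S → ℝ)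
    (hπ : ∀ s, (Measure.infinitePi (fun _ : FreeGroup (Fin n) => ν)).real ((F ∘ rst B) ⁻¹' {s}) = π s) :
    n * (∑ s, ∑ t, (if R s t then π s * π t else 0)) ≤ ∑ s, Real.negMulLog (π s) := by
  set μ := Measure.infinitePi (fun _ : FreeGroup (Fin n) => ν) with hμ
  have hX : FM (F ∘ rst B) := (FM_rst B).comp F
  have h1 := Finv_nonneg ν (X := F ∘ rst B) B hX (by intro x y h; simp [h])
  have hH : rvEnt μ (F ∘ rst B) = ∑ s, Real.negMulLog (π s) := by
    unfold rvEnt; simp_rw [hπ]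
  have h2 : ∀ i : Fin n, ∑ s, ∑ t, (if R s t then π s * π t else 0) ≤
      2 * rvEnt μ (F ∘ rst B) - rvEnt μ (fun x => ((F ∘ rst B) x, (F ∘ rst B) (gens n i x))) := by
    intro i
    have hT : MeasurePreserving (gens n i) μ μ := sh_mp ν _
    have := rvEnt_mutual (μ := μ) hX (hX.preimage hT.measurable) R (fun x => hR i x) (by
      intro s
      rw [Set.preimage_comp, measureReal_def, hT.measure_preimage (hX s).nullMeasurableSet,
        measureReal_def])
    simp_rw [hπ] at this
    exact this
  have h3 := Finset.sum_le_sum (fun i (_ : i ∈ Finset.univ) => h2 i)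
  rw [Finset.sum_sub_distrib] at h3
  simp only [Finset.sum_const, Finset.card_univ, Fintype.card_fin, nsmul_eq_mul] at h3
  unfold Finv at h1
  rw [← hH]
  linarith

/-- Bernoulli weight -/
noncomputable def bw (q : ℝ) (a : Bool) : ℝ := if a then q else 1 - q

theorem bw_sum (q : ℝ) : ∑ a, bw q a = 1 := by simp [bw]

noncomputable def bwB {β : Type*} [Fintype β] (q : ℝ) (e : β → Bool) : ℝ := ∏ b, bw q (e b)

theorem bwB_sum {β : Type*} [Fintype β] [DecidableEq β] (q : ℝ) : ∑ e : β → Bool, bwB q e = 1 := by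
  unfold bwB
  rw [← Fintype.prod_sum (fun (_ : β) a => bw q a)]
  simp only [bw_sum, Finset.prod_const_one]

noncomputable def Qf {β : Type*} [Fintype β] [DecidableEq β] (f : (β → Bool) → Bool) (q : ℝ) (y : β → Bool) : ℝ :=
  ∑ e : β → Bool, if f (fun b => xor (y b) (e b)) then bwB q e else 0

/-- mixture of product -/
noncomputable def mixp {Y : Type*} [Fintype Y] {k : ℕ} (p Q : Y → ℝ) (s : Fin k → Bool) : ℝ :=
  ∑ y, p y * ∏ j, bw (Q y) (s j)

theorem Qf_split {β : Type*} [Fintype β] [DecidableEq β] (f : (β → Bool) → Bool) (q : ℝ) (y : β → Bool) (c : Bool) :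
    (∑ e : β → Bool, if f (fun b => xor (y b) (e b)) = c then bwB q e else 0) = bw (Qf f q y) c := by
  cases c
  · have h := bwB_sum (β := β) q
    simp only [bw, Qf]
    rw [← h, if_neg (by simp), ← Finset.sum_sub_distrib]
    refine Finset.sum_congr rfl fun e _ => ?_
    cases f (fun b => xor (y b) (e b)) <;> simp
  · simp [bw, Qf]

theorem pi_formula {n k : ℕ} (ν : Measure (Bool × (Fin k → Bool))) [IsProbabilityMeasure ν] (q : ℝ)
    (hν : ∀ a, ν.real {a} = 1 / 2 * ∏ j, bw q (a.2 j))
    (B : Finset (FreeGroup (Fin n))) (f : (B → Bool) → Bool) (s : Fin k → Bool) :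
    (Measure.infinitePi (fun _ : FreeGroup (Fin n) => ν)).real
      (((fun z : B → Bool × (Fin k → Bool) => fun j => f (fun b => xor (z b).1 ((z b).2 j))) ∘ rst B) ⁻¹' {s})
      = mixp (fun _ => (1 / 2 : ℝ) ^ B.card) (Qf f q) s := by
  classical
  rw [real_comp (FM_rst B)]
  simp_rw [rst_real, hν]
  unfold mixp
  let E : (B → Bool × (Fin k → Bool)) ≃ (B → Bool) × (Fin k → B → Bool) :=
    { toFun := fun z => (fun b => (z b).1, fun j b => (z b).2 j)
      invFun := fun w => fun b => (w.1 b, fun j => w.2 j b)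
      left_inv := fun z => rfl
      right_inv := fun w => rfl }
  rw [← E.symm.sum_comp, Fintype.sum_prod_type]
  refine Finset.sum_congr rfl fun y _ => ?_
  simp_rw [← Qf_split]
  rw [Fintype.prod_sum (fun (j : Fin k) (e : B → Bool) => if f (fun b => xor (y b) (e b)) = s j then bwB q e else 0),
    Finset.mul_sum]
  refine Finset.sum_congr rfl fun ε _ => ?_
  simp only [E, Equiv.coe_fn_symm_mk, Finset.prod_mul_distrib, Finset.prod_const, Finset.card_univ,
    Fintype.card_coe]
  by_cases h : ∀ j, f (fun b => xor (y b) (ε j b)) = s j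
  · rw [if_pos (funext h)]
    simp_rw [h, if_true, bwB]
    rw [Finset.prod_comm]
  · rw [if_neg (fun h' => h (fun j => congrFun h' j))]
    push Not at h
    obtain ⟨j, hj⟩ := h
    rw [Finset.prod_eq_zero (Finset.mem_univ j) (by rw [if_neg hj]), mul_zero]

theorem bw_nonneg {q : ℝ} (h0 : 0 ≤ q) (h1 : q ≤ 1) (a : Bool) : 0 ≤ bw q a := by
  cases a <;> simp [bw] <;> linarith

theorem D_formula {Y : Type*} [Fintype Y] {k : ℕ} (p Q : Y → ℝ) (hp : ∑ y, p y = 1) :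
    (∑ s : Fin k → Bool, ∑ t : Fin k → Bool, if (∃ j, s j = true ∧ t j = true) then mixp p Q s * mixp p Q t else 0)
     = ∑ y, ∑ y', p y * p y' * (1 - (1 - Q y * Q y') ^ k) := by
  classical
  have key : ∀ y y', (∑ s : Fin k → Bool, ∑ t : Fin k → Bool, if (∃ j, s j = true ∧ t j = true) then
      (∏ j, bw (Q y) (s j)) * (∏ j, bw (Q y') (t j)) else 0) = 1 - (1 - Q y * Q y') ^ k := by
    intro y y'
    have h1 : (∑ s : Fin k → Bool, ∑ t : Fin k → Bool, 
      (∏ j, bw (Q y) (s j)) * (∏ j, bw (Q y') (t j))) = 1 := by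
      rw [← Finset.sum_mul_sum]
      have := bwB_sum (β := Fin k) (Q y)
      have h' := bwB_sum (β := Fin k) (Q y')
      unfold bwB at this h'
      rw [this, h', one_mul]
    have h2 : (∑ s : Fin k → Bool, ∑ t : Fin k → Bool, if ¬ (∃ j, s j = true ∧ t j = true) then
      (∏ j, bw (Q y) (s j)) * (∏ j, bw (Q y') (t j)) else 0) = (1 - Q y * Q y') ^ k := by
      have h3 : ∑ ab : Bool × Bool, (if ¬ (ab.1 = true ∧ ab.2 = true) then bw (Q y) ab.1 * bw (Q y') ab.2 else 0)
        = 1 - Q y * Q y' := by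
        rw [Fintype.sum_prod_type]; simp [bw]; ring
      have h4 : ∏ _j : Fin k, ∑ ab : Bool × Bool, (if ¬ (ab.1 = true ∧ ab.2 = true) then bw (Q y) ab.1 * bw (Q y') ab.2 else 0) = (1 - Q y * Q y') ^ k := by
        rw [h3]; simp
      rw [← h4, Fintype.prod_sum (fun (_ : Fin k) (ab : Bool × Bool) => (if ¬ (ab.1 = true ∧ ab.2 = true) then bw (Q y) ab.1 * bw (Q y') ab.2 else 0))]
      rw [← (Equiv.arrowProdEquivProdArrow (Fin k) (fun _ => Bool) (fun _ => Bool)).symm.sum_comp, Fintype.sum_prod_type]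
      refine Finset.sum_congr rfl fun s _ => Finset.sum_congr rfl fun t _ => ?_
      simp only [Equiv.arrowProdEquivProdArrow, Equiv.coe_fn_symm_mk]
      by_cases h : ∃ j, s j = true ∧ t j = true
      · rw [if_neg (not_not.2 h)]
        obtain ⟨j, hj⟩ := h
        symm
        apply Finset.prod_eq_zero (Finset.mem_univ j)
        exact if_neg (not_not.2 hj)
      · rw [if_pos h, ← Finset.prod_mul_distrib]
        refine Finset.prod_congr rfl fun j _ => ?_
        exact (if_pos (fun hj => h ⟨j, hj⟩)).symm
    rw [← h2, ← h1, ← Finset.sum_sub_distrib]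
    refine Finset.sum_congr rfl fun s _ => ?_
    rw [← Finset.sum_sub_distrib]
    refine Finset.sum_congr rfl fun t _ => ?_
    split_ifs <;> simp_all
  simp_rw [← key]
  have : ∀ s t : Fin k → Bool, (if (∃ j, s j = true ∧ t j = true) then mixp p Q s * mixp p Q t else 0) =
      ∑ y, ∑ y', p y * p y' * (if (∃ j, s j = true ∧ t j = true) then
      (∏ j, bw (Q y) (s j)) * (∏ j, bw (Q y') (t j)) else 0) := by
    intro s t
    split_ifs
    · unfold mixp
      rw [Finset.sum_mul_sum]
      refine Finset.sum_congr rfl fun s _ => Finset.sum_congr rfl fun t _ => ?_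
      ring
    · simp
  simp_rw [this, Finset.mul_sum]
  simp_rw [Finset.sum_comm (s := (Finset.univ : Finset (Fin k → Bool))) (t := (Finset.univ : Finset Y))]

theorem mixp_nonneg {Y : Type*} [Fintype Y] {k : ℕ} {p Q : Y → ℝ} (hp : ∀ y, 0 ≤ p y)
    (hQ : ∀ y, 0 ≤ Q y) (hQ1 : ∀ y, Q y ≤ 1) (s : Fin k → Bool) : 0 ≤ mixp p Q s :=
  Finset.sum_nonneg fun y _ => mul_nonneg (hp y) (Finset.prod_nonneg fun j _ => bw_nonneg (hQ y) (hQ1 y) _)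

theorem mixp_sum {Y : Type*} [Fintype Y] {k : ℕ} {p Q : Y → ℝ} (hp : ∑ y, p y = 1) :
    ∑ s : Fin k → Bool, mixp p Q s = 1 := by
  unfold mixp
  rw [Finset.sum_comm]
  simp_rw [← Finset.mul_sum]
  rw [← hp]
  refine Finset.sum_congr rfl fun y _ => ?_
  have := bwB_sum (β := Fin k) (Q y)
  unfold bwB at this
  rw [this, mul_one]

theorem mixp_empty {Y : Type*} [Fintype Y] {k : ℕ} (p Q : Y → ℝ) :
    mixp (k := k) p Q (fun _ => false) = ∑ y, p y * (1 - Q y) ^ k := by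
  simp [mixp, bw]

theorem nml_le {p c : ℝ} (hp : 0 ≤ p) (hc : 0 < c) : Real.negMulLog p ≤ p * Real.log (1 / c) + (c - p) := by
  rcases hp.eq_or_lt with rfl | hp
  · simp [hc.le]
  have h := Real.log_le_sub_one_of_pos (div_pos hc hp)
  rw [Real.log_div hc.ne' hp.ne'] at h
  rw [Real.negMulLog, one_div, Real.log_inv]
  have h2 := mul_le_mul_of_nonneg_left h hp.le
  have h3 : p * (c / p - 1) = c - p := by field_simp
  rw [h3] at h2
  linarith

/-- Entropy upper bounds -/
theorem ent_crude {k : ℕ} (π : (Fin k → Bool) → ℝ) (h0 : ∀ s, 0 ≤ π s) (h1 : ∑ s, π s = 1) :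
    ∑ s, Real.negMulLog (π s) ≤ k * Real.log 2 := by
  have := Finset.sum_le_sum (fun s (_ : s ∈ Finset.univ) => nml_le (h0 s) (c := (1/2 : ℝ)^k) (by positivity))
  refine this.trans ?_
  rw [Finset.sum_add_distrib, Finset.sum_sub_distrib, ← Finset.sum_mul, h1]
  simp [Real.log_pow]

theorem ent_fine {k : ℕ} (π : (Fin k → Bool) → ℝ) (h0 : ∀ s, 0 ≤ π s) (h1 : ∑ s, π s = 1) (P : ℝ)
    (hP : 0 < P) (hP0 : π (fun _ => false) = 1 - P) :
    ∑ s, Real.negMulLog (π s) ≤ P * (Real.log (1 / P) + 1 + k * Real.log 2) := by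
  classical
  have e1 := Finset.add_sum_erase Finset.univ (fun s => Real.negMulLog (π s)) (Finset.mem_univ (fun _ => false))
  have e2 := Finset.add_sum_erase Finset.univ π (Finset.mem_univ (fun _ => false))
  rw [h1, hP0] at e2
  rw [← e1]
  have hc : 0 < P * (1/2 : ℝ)^k := by positivity
  have h2 := nml_le (h0 (fun _ => false)) (c := 1) one_pos
  have := Finset.sum_le_sum (fun s (_ : s ∈ Finset.univ.erase (fun _ => false)) => nml_le (h0 s) hc)
  rw [Finset.sum_add_distrib, Finset.sum_sub_distrib, ← Finset.sum_mul] at this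
  have e3 : ∑ s ∈ Finset.univ.erase (fun _ => false), π s = P := by linarith
  rw [e3] at this
  have e4 : ∑ s ∈ (Finset.univ : Finset (Fin k → Bool)).erase (fun _ => false), P * (1/2 : ℝ)^k ≤ P := by
    rw [Finset.sum_const, nsmul_eq_mul, Finset.card_erase_of_mem (Finset.mem_univ _)]
    have h5 : (((Finset.univ : Finset (Fin k → Bool)).card - 1 : ℕ) : ℝ) ≤ 2 ^ k := by
      simp
    calc _ ≤ 2 ^ k * (P * (1/2 : ℝ)^k) := mul_le_mul_of_nonneg_right h5 hc.le
      _ = P := by rw [one_div, inv_pow]; field_simp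
  have e5 : Real.log (1 / (P * (1/2 : ℝ)^k)) = Real.log (1 / P) + k * Real.log 2 := by
    rw [one_div, Real.log_inv, Real.log_mul hP.ne' (by positivity), Real.log_pow, one_div, one_div, Real.log_inv, Real.log_inv]
    ring
  rw [e5] at this
  rw [hP0] at h2 ⊢
  simp only [div_one, Real.log_one, mul_zero] at h2
  nlinarith

set_option linter.unusedSectionVars false

noncomputable def ph (k : ℕ) (x : ℝ) : ℝ := 1 - (1 - x) ^ k

theorem ph_mul {k : ℕ} {x y : ℝ} (hx0 : 0 ≤ x) (hx1 : x ≤ 1) (hy0 : 0 ≤ y) (hy1 : y ≤ 1) :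
    y * ph k x ≤ ph k (x * y) := by
  unfold ph
  have m1 : (1 : ℝ) ∈ Set.Ici (0 : ℝ) := by simp
  have m2 : (1 - x : ℝ) ∈ Set.Ici (0 : ℝ) := by simp; linarith
  have h := (convexOn_pow (𝕜 := ℝ) k).2 m1 m2 (show 0 ≤ 1 - y by linarith) hy0 (by ring)
  simp only [smul_eq_mul, mul_one, one_pow] at h
  have e : 1 - y + y * (1 - x) = 1 - x * y := by ring
  rw [e] at h
  nlinarith

theorem ph_mono {k : ℕ} {x y : ℝ} (hxy : x ≤ y) (hy1 : y ≤ 1) : ph k x ≤ ph k y := by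
  unfold ph
  have := pow_le_pow_left₀ (show 0 ≤ 1 - y by linarith) (show 1 - y ≤ 1 - x by linarith) k
  linarith

theorem ph_nonneg {k : ℕ} {x : ℝ} (hx0 : 0 ≤ x) (hx1 : x ≤ 1) : 0 ≤ ph k x := by
  have := ph_mono (k := k) hx0 hx1
  simpa [ph] using this

theorem ph_le_one {k : ℕ} {x : ℝ} (hx1 : x ≤ 1) : ph k x ≤ 1 := by
  unfold ph
  have := pow_nonneg (show 0 ≤ 1 - x by linarith) k
  linarith

theorem ph_ge {k : ℕ} (hk : k ≠ 0) {x : ℝ} (hx0 : 0 ≤ x) (hx1 : x ≤ 1) : x ≤ ph k x := by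
  have := ph_mul (k := k) (x := 1) zero_le_one le_rfl hx0 hx1
  simpa [ph, hk] using this

theorem ph_small {k : ℕ} {x y t η c : ℝ} (hx0 : 0 ≤ x) (hx1 : x ≤ 1) (hy0 : 0 ≤ y) (hy1 : y ≤ 1)
    (ht0 : 0 < t) (ht1 : t ≤ 1) (hη : ph k (t ^ 2) = 1 - η) (hη0 : 0 ≤ η) (hη1 : η < 1)
    (hc : c = t / (1 - η)) (hxt : x ≤ t) :
    (1 - η) * (y * ph k x + x * ph k y) - x * y - 2 * c * (ph k x * ph k y) ≤ ph k (x * y) := by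
  have h1 := ph_mul (k := k) hx0 hx1 hy0 hy1
  have h2 := ph_mul (k := k) ht0.le ht1 (div_nonneg hx0 ht0.le) ((div_le_one ht0).2 hxt)
  rw [mul_div_cancel₀ _ ht0.ne'] at h2
  have h3 : 1 - η ≤ ph k t := by rw [← hη]; exact ph_mono (by nlinarith) ht1
  have h1η : 0 < 1 - η := by linarith
  have h4 : x ≤ c * ph k x := by
    have h5 : x / t * (1 - η) ≤ ph k x := le_trans (mul_le_mul_of_nonneg_left h3 (div_nonneg hx0 ht0.le)) h2
    have hc0 : 0 < c := by rw [hc]; exact div_pos ht0 h1η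
    have := mul_le_mul_of_nonneg_left h5 hc0.le
    calc x = c * (x / t * (1 - η)) := by rw [hc]; field_simp
      _ ≤ _ := this
  have hc0 : 0 < c := by rw [hc]; exact div_pos ht0 h1η
  have py := ph_nonneg (k := k) hy0 hy1
  have px := ph_nonneg (k := k) hx0 hx1
  have h6 : x * ph k y ≤ c * ph k x * ph k y := mul_le_mul_of_nonneg_right h4 py
  have h7 : 0 ≤ c * ph k x * ph k y := by positivity
  have h8 : 0 ≤ y * ph k x := by positivity
  have h9 : 0 ≤ x * ph k y := by positivity
  have h10 : 0 ≤ x * y := by positivity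
  nlinarith [mul_nonneg hη0 (add_nonneg h8 h9)]

theorem ph_key {k : ℕ} {x y t η c : ℝ} (hx0 : 0 ≤ x) (hx1 : x ≤ 1) (hy0 : 0 ≤ y) (hy1 : y ≤ 1)
    (ht0 : 0 < t) (ht1 : t ≤ 1) (hη : ph k (t ^ 2) = 1 - η) (hη0 : 0 ≤ η) (hη1 : η < 1)
    (hc : c = t / (1 - η)) :
    (1 - η) * (y * ph k x + x * ph k y) - x * y - 2 * c * (ph k x * ph k y) ≤ ph k (x * y) := by
  rcases le_total x t with hxt | hxt
  · exact ph_small hx0 hx1 hy0 hy1 ht0 ht1 hη hη0 hη1 hc hxt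
  rcases le_total y t with hyt | hyt
  · have := ph_small (k := k) hy0 hy1 hx0 hx1 ht0 ht1 hη hη0 hη1 hc hyt
    rw [mul_comm y x] at this
    linarith
  have h1 : 1 - η ≤ ph k (x * y) := by
    rw [← hη]
    exact ph_mono (by nlinarith) (by nlinarith)
  have px := ph_nonneg (k := k) hx0 hx1
  have py := ph_nonneg (k := k) hy0 hy1
  have px1 := ph_le_one (k := k) hx1
  have py1 := ph_le_one (k := k) hy1
  have h1η : 0 < 1 - η := by linarith
  have hc0 : 0 < c := by rw [hc]; exact div_pos ht0 h1η
  have h7 : 0 ≤ c * (ph k x * ph k y) := by positivity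
  have h2 : y * ph k x + x * ph k y ≤ y + x := by nlinarith
  have h3 : y + x ≤ 1 + x * y := by nlinarith
  have h4 := mul_le_mul_of_nonneg_left (h2.trans h3) h1η.le
  have h10 : 0 ≤ x * y := by positivity
  nlinarith [mul_nonneg hη0 h10]

theorem abs_D {Y : Type*} [Fintype Y] {k : ℕ} {p Q : Y → ℝ} (hp : ∀ y, 0 ≤ p y)
    (hQ0 : ∀ y, 0 ≤ Q y) (hQ1 : ∀ y, Q y ≤ 1) {t η c ρ P : ℝ}
    (ht0 : 0 < t) (ht1 : t ≤ 1) (hη : ph k (t ^ 2) = 1 - η) (hη0 : 0 ≤ η) (hη1 : η < 1)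
    (hc : c = t / (1 - η)) (hρ : ∑ y, p y * Q y = ρ) (hP : ∑ y, p y * ph k (Q y) = P) :
    2 * (1 - η) * ρ * P - ρ ^ 2 - 2 * c * P ^ 2 ≤ ∑ y, ∑ y', p y * p y' * ph k (Q y * Q y') := by
  have e : 2 * (1 - η) * ρ * P - ρ ^ 2 - 2 * c * P ^ 2 =
    ∑ y, ∑ y', p y * p y' * ((1 - η) * (Q y' * ph k (Q y) + Q y * ph k (Q y')) - Q y * Q y' - 2 * c * (ph k (Q y) * ph k (Q y'))) := by
    have : ∀ y y', p y * p y' * ((1 - η) * (Q y' * ph k (Q y) + Q y * ph k (Q y')) - Q y * Q y' - 2 * c * (ph k (Q y) * ph k (Q y'))) =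
      (1 - η) * ((p y * ph k (Q y)) * (p y' * Q y')) + (1 - η) * ((p y * Q y) * (p y' * ph k (Q y'))) - (p y * Q y) * (p y' * Q y')
       - 2 * c * ((p y * ph k (Q y)) * (p y' * ph k (Q y'))) := by intros; ring
    simp_rw [this, Finset.sum_sub_distrib, Finset.sum_add_distrib, ← Finset.mul_sum, ← Finset.sum_mul, hρ, hP]
    ring
  rw [e]
  refine Finset.sum_le_sum fun y _ => Finset.sum_le_sum fun y' _ => ?_
  exact mul_le_mul_of_nonneg_left (ph_key (hQ0 y) (hQ1 y) (hQ0 y') (hQ1 y') ht0 ht1 hη hη0 hη1 hc) (mul_nonneg (hp y) (hp y'))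

theorem abs_upper {Y : Type*} [Fintype Y] {k : ℕ} {p Q : Y → ℝ} (hp : ∀ y, 0 ≤ p y) (hp1 : ∑ y, p y = 1)
    (hQ0 : ∀ y, 0 ≤ Q y) (hQ1 : ∀ y, Q y ≤ 1) {K ρ N : ℝ} (hN : 0 ≤ N) (hK : 2 ≤ K)
    (hk : (1 - (1 / K ^ 3) ^ 2) ^ k ≤ 1 / K)
    (hρ : ∑ y, p y * Q y = ρ) (hρ0 : 0 < ρ) (hP : ∑ y, p y * ph k (Q y) = K * ρ)
    (hD : N * ∑ y, ∑ y', p y * p y' * ph k (Q y * Q y') ≤ ∑ s : Fin k → Bool, Real.negMulLog (mixp p Q s)) :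
    N * ρ * (2 - 7 / K) ≤ Real.log (1 / ρ) + 1 + k * Real.log 2 := by
  have hK0 : 0 < K := by linarith
  set t := 1 / K ^ 3 with ht
  have ht0 : 0 < t := by positivity
  have ht1 : t ≤ 1 := by
    rw [ht, div_le_one (by positivity)]
    exact one_le_pow₀ (by linarith)
  set η := (1 - t ^ 2) ^ k with hη
  have hK2 : 1 / K ≤ 1 / 2 := one_div_le_one_div_of_le (by norm_num) hK
  have hη0 : 0 ≤ η := pow_nonneg (by nlinarith) k
  have hη1 : η < 1 := by linarith
  have h1η : 0 < 1 - η := by linarith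
  have key := abs_D (k := k) hp hQ0 hQ1 ht0 ht1 (by rw [ph]) hη0 hη1 rfl hρ hP
  have hc : t / (1 - η) ≤ 2 * t := by
    rw [div_le_iff₀ h1η]; nlinarith
  have htK : K ^ 2 * t = 1 / K := by rw [ht]; field_simp
  have low : K * ρ ^ 2 * (2 - 7 / K) ≤ 2 * (1 - η) * ρ * (K * ρ) - ρ ^ 2 - 2 * (t / (1 - η)) * (K * ρ) ^ 2 := by
    have a1 : K * ρ ^ 2 * (2 - 7 / K) = 2 * K * ρ ^ 2 - 7 * ρ ^ 2 := by field_simp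
    have a2 : η * (K * ρ ^ 2) ≤ ρ ^ 2 := by
      calc _ ≤ 1 / K * (K * ρ ^ 2) := mul_le_mul_of_nonneg_right hk (by positivity)
        _ = _ := by field_simp
    have a3 : (t / (1 - η)) * (K * ρ) ^ 2 ≤ ρ ^ 2 := by
      calc _ ≤ 2 * t * (K * ρ) ^ 2 := mul_le_mul_of_nonneg_right hc (by positivity)
        _ = 2 * (K ^ 2 * t) * ρ ^ 2 := by ring
        _ = 2 * (1 / K) * ρ ^ 2 := by rw [htK]
        _ ≤ _ := by nlinarith [sq_nonneg ρ]
    rw [a1]; nlinarith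
  have hmp : mixp (k := k) p Q (fun _ => false) = 1 - K * ρ := by
    rw [mixp_empty, ← hP]
    nth_rw 2 [← hp1]
    rw [← Finset.sum_sub_distrib]
    refine Finset.sum_congr rfl fun y _ => ?_
    simp only [ph]; ring
  have hKρ : 0 < K * ρ := by positivity
  have up := ent_fine (mixp (k := k) p Q) (mixp_nonneg hp hQ0 hQ1) (mixp_sum hp1) (K * ρ) hKρ hmp
  have hlog : Real.log (1 / (K * ρ)) ≤ Real.log (1 / ρ) :=
    Real.log_le_log (by positivity) (one_div_le_one_div_of_le hρ0 (by nlinarith))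
  have f1 : K * ρ * (N * ρ * (2 - 7 / K)) ≤ K * ρ * (Real.log (1 / ρ) + 1 + k * Real.log 2) := by
    calc K * ρ * (N * ρ * (2 - 7 / K)) = N * (K * ρ ^ 2 * (2 - 7 / K)) := by ring
      _ ≤ N * _ := mul_le_mul_of_nonneg_left (low.trans key) hN
      _ ≤ _ := hD
      _ ≤ _ := up
      _ ≤ _ := mul_le_mul_of_nonneg_left (by linarith) hKρ.le
  exact le_of_mul_le_mul_left f1 hKρ

theorem abs_crude {Y : Type*} [Fintype Y] {k : ℕ} (hk : k ≠ 0) {p Q : Y → ℝ} (hp : ∀ y, 0 ≤ p y) (hp1 : ∑ y, p y = 1)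
    (hQ0 : ∀ y, 0 ≤ Q y) (hQ1 : ∀ y, Q y ≤ 1) {ρ N : ℝ} (hN : 0 ≤ N)
    (hρ : ∑ y, p y * Q y = ρ)
    (hD : N * ∑ y, ∑ y', p y * p y' * ph k (Q y * Q y') ≤ ∑ s : Fin k → Bool, Real.negMulLog (mixp p Q s)) :
    N * ρ ^ 2 ≤ k * Real.log 2 := by
  have e : ρ ^ 2 = ∑ y, ∑ y', p y * p y' * (Q y * Q y') := by
    rw [sq, ← hρ, Finset.sum_mul_sum]
    refine Finset.sum_congr rfl fun y _ => Finset.sum_congr rfl fun y' _ => by ring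
  have h : ρ ^ 2 ≤ ∑ y, ∑ y', p y * p y' * ph k (Q y * Q y') := by
    rw [e]
    refine Finset.sum_le_sum fun y _ => Finset.sum_le_sum fun y' _ => ?_
    exact mul_le_mul_of_nonneg_left (ph_ge hk (mul_nonneg (hQ0 y) (hQ0 y'))
      (mul_le_one₀ (hQ1 y) (hQ0 y') (hQ1 y'))) (mul_nonneg (hp y) (hp y'))
  exact (mul_le_mul_of_nonneg_left h hN).trans (hD.trans (ent_crude _ (mixp_nonneg hp hQ0 hQ1) (mixp_sum hp1)))

section Qsec
variable {β : Type*} [Fintype β] [DecidableEq β] (f : (β → Bool) → Bool)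

theorem bwB_nonneg {q : ℝ} (h0 : 0 ≤ q) (h1 : q ≤ 1) (e : β → Bool) : 0 ≤ bwB q e :=
  Finset.prod_nonneg fun _ _ => bw_nonneg h0 h1 _

theorem Qf_nonneg {q : ℝ} (h0 : 0 ≤ q) (h1 : q ≤ 1) (y : β → Bool) : 0 ≤ Qf f q y :=
  Finset.sum_nonneg fun e _ => by split_ifs; exacts [bwB_nonneg h0 h1 e, le_rfl]

theorem Qf_le_one {q : ℝ} (h0 : 0 ≤ q) (h1 : q ≤ 1) (y : β → Bool) : Qf f q y ≤ 1 := by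
  rw [← bwB_sum (β := β) q]
  exact Finset.sum_le_sum fun e _ => by split_ifs; exacts [le_rfl, bwB_nonneg h0 h1 e]

def xorEquiv (e : β → Bool) : (β → Bool) ≃ (β → Bool) where
  toFun y := fun b => xor (y b) (e b)
  invFun y := fun b => xor (y b) (e b)
  left_inv y := by funext b; simp
  right_inv y := by funext b; simp

noncomputable def rho : ℝ := ∑ y : β → Bool, (1 / 2 : ℝ) ^ (Fintype.card β) * (if f y then 1 else 0)

theorem Qf_mean (q : ℝ) : ∑ y : β → Bool, (1 / 2 : ℝ) ^ (Fintype.card β) * Qf f q y = rho f := by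
  unfold Qf rho
  simp_rw [← Finset.mul_sum]
  congr 1
  rw [Finset.sum_comm]
  have : ∀ e : β → Bool, (∑ y : β → Bool, if f (fun b => xor (y b) (e b)) then bwB q e else 0) =
      bwB q e * ∑ y : β → Bool, (if f y then 1 else 0) := by
    intro e
    rw [← (xorEquiv e).sum_comp, Finset.mul_sum]
    refine Finset.sum_congr rfl fun y _ => ?_
    simp [xorEquiv]
  simp_rw [this, ← Finset.sum_mul, bwB_sum, one_mul]

theorem Qf_zero (y : β → Bool) : Qf f 0 y = if f y then 1 else 0 := by
  unfold Qf
  rw [Finset.sum_eq_single (fun _ => false)]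
  · simp [bwB, bw]
  · intro e _ he
    have : ∃ b, e b = true := by
      by_contra h
      push Not at h
      exact he (funext fun b => by simpa using h b)
    obtain ⟨b, hb⟩ := this
    have : bwB 0 e = 0 := Finset.prod_eq_zero (Finset.mem_univ b) (by simp [bw, hb])
    simp [this]
  · simp

theorem Qf_half (y : β → Bool) : Qf f (1 / 2) y = rho f := by
  unfold Qf rho
  have : ∀ e : β → Bool, bwB (1 / 2) e = (1 / 2 : ℝ) ^ (Fintype.card β) := by
    intro e
    have : ∀ a, bw (1 / 2) a = 1 / 2 := by intro a; cases a <;> norm_num [bw]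
    simp only [bwB, this, Finset.prod_const, Finset.card_univ]
  simp_rw [this]
  rw [← (xorEquiv y).sum_comp]
  refine Finset.sum_congr rfl fun e _ => ?_
  simp only [xorEquiv, Equiv.coe_fn_mk, Bool.xor_comm (e _)]
  simp

theorem unif_sum : ∑ _y : β → Bool, (1 / 2 : ℝ) ^ (Fintype.card β) = 1 := by
  simp

theorem Qf_cont (y : β → Bool) : Continuous fun q => Qf f q y := by
  unfold Qf bwB bw
  refine continuous_finsetSum _ fun e _ => ?_
  split_ifs
  · refine continuous_finsetProd _ fun b _ => ?_
    split_ifs <;> fun_prop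
  · fun_prop

theorem exists_q {k : ℕ} {K : ℝ} (hK : 1 ≤ K) (hk : 2 * K ≤ k) (hρ0 : 0 < rho f) (hρ : rho f ≤ 1 / (2 * K)) :
    ∃ q : ℝ, 0 ≤ q ∧ q ≤ 1 ∧
      ∑ y : β → Bool, (1 / 2 : ℝ) ^ (Fintype.card β) * ph k (Qf f q y) = K * rho f := by
  have hk0 : k ≠ 0 := by rintro rfl; norm_num at hk; linarith
  have hK0 : 0 < K := by linarith
  have hc : Continuous fun q => ∑ y : β → Bool, (1 / 2 : ℝ) ^ (Fintype.card β) * ph k (Qf f q y) := by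
    refine continuous_finsetSum _ fun y _ => ?_
    unfold ph
    have := Qf_cont f y
    fun_prop
  have h0 : ∑ y : β → Bool, (1 / 2 : ℝ) ^ (Fintype.card β) * ph k (Qf f 0 y) ≤ K * rho f := by
    have : ∑ y : β → Bool, (1 / 2 : ℝ) ^ (Fintype.card β) * ph k (Qf f 0 y) = rho f := by
      unfold rho
      refine Finset.sum_congr rfl fun y _ => ?_
      rw [Qf_zero]
      split_ifs <;> simp [ph, hk0]
    rw [this]; nlinarith
  have h1 : K * rho f ≤ ∑ y : β → Bool, (1 / 2 : ℝ) ^ (Fintype.card β) * ph k (Qf f (1 / 2) y) := by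
    simp_rw [Qf_half, ← Finset.sum_mul, unif_sum, one_mul]
    set ρ := rho f
    have hρ' : K * ρ ≤ 1 / 2 := by
      have := mul_le_mul_of_nonneg_left hρ hK0.le
      have e : K * (1 / (2 * K)) = 1 / 2 := by field_simp
      linarith
    have hρ1 : ρ ≤ 1 := by nlinarith
    have b1 : 1 + k * ρ ≤ (1 + ρ) ^ k := one_add_mul_le_pow (by linarith) k
    have b2 : (1 - ρ) ^ k * (1 + ρ) ^ k ≤ 1 := by
      rw [← mul_pow]
      exact pow_le_one₀ (by nlinarith) (by nlinarith)
    have b3 : 0 ≤ (1 - ρ) ^ k := pow_nonneg (by linarith) k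
    have b4 : (1 - ρ) ^ k * (1 + k * ρ) ≤ 1 := le_trans (mul_le_mul_of_nonneg_left b1 b3) b2
    unfold ph
    have hkρ : 0 < 1 + k * ρ := by positivity
    have b5 : 1 ≤ (1 - K * ρ) * (1 + k * ρ) := by
      have : K * (1 + k * ρ) ≤ k := by nlinarith [Nat.cast_nonneg (α := ℝ) k]
      nlinarith
    have := le_of_mul_le_mul_right (b4.trans b5) hkρ
    linarith
  obtain ⟨q, hq, hq'⟩ := intermediate_value_Icc (show (0 : ℝ) ≤ 1 / 2 by norm_num) hc.continuousOn ⟨h0, h1⟩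
  exact ⟨q, hq.1, by linarith [hq.2], hq'⟩
end Qsec

theorem main_ineq {n k : ℕ} (B : Finset (FreeGroup (Fin n))) (f : (B → Bool) → Bool)
    (hf : ∀ (i : Fin n) (x : FreeGroup (Fin n) → Bool), ¬ (f (rst B x) = true ∧ f (rst B (gens n i x)) = true))
    {q : ℝ} (h0 : 0 ≤ q) (h1 : q ≤ 1) :
    n * ∑ y, ∑ y', (1 / 2 : ℝ) ^ (Fintype.card B) * (1 / 2 : ℝ) ^ (Fintype.card B) * ph k (Qf f q y * Qf f q y') ≤
      ∑ s : Fin k → Bool, Real.negMulLog (mixp (fun _ => (1 / 2 : ℝ) ^ (Fintype.card B)) (Qf f q) s) := by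
  classical
  obtain ⟨ν, hν, hνw⟩ := exists_measure_weights (A := Bool × (Fin k → Bool))
    (fun a => 1 / 2 * ∏ j, bw q (a.2 j))
    (fun a => mul_nonneg (by norm_num) (Finset.prod_nonneg fun _ _ => bw_nonneg h0 h1 _)) (by
      rw [Fintype.sum_prod_type]
      have := bwB_sum (β := Fin k) q
      unfold bwB at this
      simp only [← Finset.mul_sum, this]
      norm_num)
  have := ent_ineq ν B (fun z j => f (fun b => xor (z b).1 ((z b).2 j)))
    (fun s t => ∃ j, s j = true ∧ t j = true) (by
      rintro i x ⟨j, hj⟩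
      exact hf i (fun γ => xor (x γ).1 ((x γ).2 j)) hj) (mixp (fun _ => (1 / 2 : ℝ) ^ (Fintype.card B)) (Qf f q))
    (fun s => by rw [Fintype.card_coe]; exact pi_formula ν q hνw B f s)
  rw [D_formula _ _ unif_sum] at this
  exact this

theorem clopen_bound {n k : ℕ} {K : ℝ} (hK : 2 ≤ K) (hk2 : 2 * K ≤ k)
    (hk : (1 - (1 / K ^ 3) ^ 2) ^ k ≤ 1 / K) (B : Finset (FreeGroup (Fin n))) (f : (B → Bool) → Bool)
    (hf : ∀ (i : Fin n) (x : FreeGroup (Fin n) → Bool), ¬ (f (rst B x) = true ∧ f (rst B (gens n i x)) = true))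
    (hρ0 : 0 < rho f) :
    n * rho f ^ 2 ≤ k * Real.log 2 ∧
      (rho f ≤ 1 / (2 * K) → n * rho f * (2 - 7 / K) ≤ Real.log (1 / rho f) + 1 + k * Real.log 2) := by
  have hk0 : k ≠ 0 := by rintro rfl; norm_num at hk2; linarith
  constructor
  · exact abs_crude hk0 (fun _ => by positivity) unif_sum (Qf_nonneg f le_rfl zero_le_one)
      (Qf_le_one f le_rfl zero_le_one) (Nat.cast_nonneg n) (Qf_mean f 0) (main_ineq B f hf le_rfl zero_le_one)
  · intro hρ
    obtain ⟨q, q0, q1, hq⟩ := exists_q f (k := k) (by linarith) hk2 hρ0 hρ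
    exact abs_upper (fun _ => by positivity) unif_sum (Qf_nonneg f q0 q1) (Qf_le_one f q0 q1)
      (Nat.cast_nonneg n) hK hk (Qf_mean f q) hρ0 hq (main_ineq B f hf q0 q1)

set_option linter.unusedSectionVars false

/-- `J` depends only on coordinates in `B`. -/
def DepOn {Γ : Type*} (J : Set (Γ → Bool)) (B : Set Γ) : Prop :=
  ∀ x y : Γ → Bool, (∀ b ∈ B, x b = y b) → x ∈ J → y ∈ J

theorem DepOn.exists_f {Γ : Type*} [DecidableEq Γ] {J : Set (Γ → Bool)} {B : Finset Γ} (h : DepOn J (B : Set Γ)) :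
    ∃ f : (B → Bool) → Bool, ∀ x, x ∈ J ↔ f (rst B x) = true := by
  classical
  refine ⟨fun z => decide ((fun γ => if hγ : γ ∈ B then z ⟨γ, hγ⟩ else false) ∈ J), fun x => ?_⟩
  rw [decide_eq_true_iff]
  constructor
  · refine h _ _ fun b hb => ?_
    rw [Finset.mem_coe] at hb
    simp [hb, rst]
  · refine h _ _ fun b hb => ?_
    rw [Finset.mem_coe] at hb
    simp [hb, rst]

theorem bern_fiber {Γ : Type*} [Group Γ] {β : Measure (Γ → Bool)} (hβ : IsBernoulliMeasure β)
    (B : Finset Γ) (φ : B → Bool) : β.real (rst B ⁻¹' {φ}) = (1 / 2 : ℝ) ^ Fintype.card B := by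
  classical
  rw [rst_fiber B φ (fun γ => if h : γ ∈ B then φ ⟨γ, h⟩ else false) (by simp), measureReal_def, hβ]
  simp

theorem bern_cyl {Γ : Type*} [Group Γ] [DecidableEq Γ] {β : Measure (Γ → Bool)} [IsProbabilityMeasure β]
    (hβ : IsBernoulliMeasure β)
    (B : Finset Γ) (f : (B → Bool) → Bool) {J : Set (Γ → Bool)} (hJ : ∀ x, x ∈ J ↔ f (rst B x) = true) :
    β.real J = rho f := by
  classical
  have : J = (f ∘ rst B) ⁻¹' {true} := by ext x; simp [hJ]
  rw [this, real_comp (FM_rst B)]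
  unfold rho
  refine Finset.sum_congr rfl fun y _ => ?_
  rw [bern_fiber hβ]
  simp

theorem exists_unif : ∃ ν : Measure Bool, IsProbabilityMeasure ν ∧ ∀ a, ν.real {a} = 1 / 2 :=
  exists_measure_weights _ (fun _ => by norm_num) (by norm_num)

theorem infPi_bern {Γ : Type*} [Group Γ] {ν : Measure Bool} [IsProbabilityMeasure ν] (h : ∀ a, ν.real {a} = 1 / 2) :
    IsBernoulliMeasure (Measure.infinitePi (fun _ : Γ => ν)) := by
  intro D φ
  have h1 := infPi_box ν D φ
  simp_rw [h] at h1
  rw [measureReal_def] at h1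
  rw [← ENNReal.ofReal_toReal (measure_ne_top _ _), h1]
  rw [Finset.prod_const, ENNReal.ofReal_pow (by norm_num), ENNReal.ofReal_div_of_pos (by norm_num)]
  simp

theorem bern_eq {Γ : Type*} [Group Γ] {β : Measure (Γ → Bool)} [IsProbabilityMeasure β]
    (hβ : IsBernoulliMeasure β) {ν : Measure Bool} [IsProbabilityMeasure ν] (h : ∀ a, ν.real {a} = 1 / 2) :
    β = Measure.infinitePi (fun _ : Γ => ν) := by
  classical
  apply Measure.eq_infinitePi
  intro s t ht
  rw [← Measure.infinitePi_pi (μ := fun _ : Γ => ν) (fun i _ => ht i)]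
  have hd : DepOn (Set.pi (s : Set Γ) t) (s : Set Γ) := by
    intro x y hxy hx i hi
    rw [← hxy i hi]; exact hx i hi
  obtain ⟨f, hf⟩ := hd.exists_f
  have h1 := bern_cyl hβ s f hf
  have h2 := bern_cyl (infPi_bern h) s f hf
  rw [← h2] at h1
  exact (measureReal_eq_measureReal_iff).1 h1

theorem bern_mp {Γ : Type*} [Group Γ] {β : Measure (Γ → Bool)} [IsProbabilityMeasure β]
    (hβ : IsBernoulliMeasure β) (γ : Γ) : MeasurePreserving (sh γ) β β := by
  obtain ⟨ν, hν, h⟩ := exists_unif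
  rw [bern_eq hβ h]
  exact sh_mp ν γ

theorem approx_cyl {n : ℕ} {β : Measure (FreeGroup (Fin n) → Bool)} [IsProbabilityMeasure β]
    (hβ : IsBernoulliMeasure β) {I : Set (FreeGroup (Fin n) → Bool)} (hI : NullMeasurableSet I β)
    (hind : ∀ i x, ¬ (x ∈ I ∧ sh (FreeGroup.of i) x ∈ I)) {δ : ℝ} (hδ : 0 < δ) :
    ∃ (B : Finset (FreeGroup (Fin n))) (f : (B → Bool) → Bool),
      (∀ (i : Fin n) (x : FreeGroup (Fin n) → Bool), ¬ (f (rst B x) = true ∧ f (rst B (gens n i x)) = true)) ∧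
      β.real I ≤ rho f + δ := by
  classical
  obtain ⟨I', hI'I, hI'm, hI'e⟩ := hI.exists_measurable_subset_ae_eq
  obtain ⟨C, hC, hCI⟩ := exists_measure_symmDiff_lt_of_generateFrom_isSetRing (μ := β)
    (C := measurableCylinders (fun _ : FreeGroup (Fin n) => Bool)) isSetRing_measurableCylinders
    ⟨{Set.univ}, by simp, Set.singleton_subset_iff.2 (univ_mem_measurableCylinders _), by simp⟩ generateFrom_measurableCylinders.symm hI'm
    (ε := ENNReal.ofReal (δ / (n + 1))) (by simp; positivity)
  obtain ⟨s, S, hS, rfl⟩ := (mem_measurableCylinders _).1 hC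
  set C : Set (FreeGroup (Fin n) → Bool) := cylinder (α := fun _ => Bool) s S with hCdef
  have hCd : ∀ x y : FreeGroup (Fin n) → Bool, (∀ b ∈ s, x b = y b) → (x ∈ C ↔ y ∈ C) := by
    intro x y h
    simp only [hCdef, mem_cylinder]
    have : s.restrict x = s.restrict y := by funext b; exact h b b.2
    rw [this]
  have hCm : MeasurableSet C := hS.cylinder
  let I0 : Set (FreeGroup (Fin n) → Bool) := {x | x ∈ C ∧ ∀ i, sh (FreeGroup.of i) x ∉ C}
  let B : Finset (FreeGroup (Fin n)) := s ∪ Finset.univ.biUnion (fun i => s.image (fun b => b * FreeGroup.of i))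
  have hd : DepOn I0 (B : Set (FreeGroup (Fin n))) := by
    intro x y hxy hx
    refine ⟨(hCd x y fun b hb => hxy b (by simp [B, hb])).1 hx.1, fun i hi => hx.2 i ?_⟩
    refine (hCd _ _ fun b hb => ?_).2 hi
    refine hxy _ ?_
    simp only [B, Finset.coe_union, Set.mem_union, Finset.mem_coe, Finset.mem_biUnion, Finset.mem_image]
    exact Or.inr ⟨i, Finset.mem_univ _, b, hb, rfl⟩
  obtain ⟨f, hf⟩ := hd.exists_f
  refine ⟨B, f, ?_, ?_⟩
  · rintro i x ⟨h1, h2⟩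
    exact ((hf x).2 h1).2 i ((hf _).2 h2).1
  · rw [← bern_cyl hβ B f hf]
    have hII : β.real I = β.real I' := by
      rw [measureReal_def, measureReal_def, measure_congr hI'e]
    rw [hII]
    have hsub : I' ⊆ I0 ∪ (symmDiff C I' ∪ ⋃ i, sh (FreeGroup.of i) ⁻¹' (symmDiff C I')) := by
      intro x hx
      by_cases hxC : x ∈ C
      · by_cases h : ∃ i, sh (FreeGroup.of i) x ∈ C
        · obtain ⟨i, hi⟩ := h
          right; right
          rw [Set.mem_iUnion]
          exact ⟨i, Or.inl ⟨hi, fun h' => hind i x ⟨hI'I hx, hI'I h'⟩⟩⟩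
        · push Not at h
          exact Or.inl ⟨hxC, h⟩
      · exact Or.inr (Or.inl (Or.inr ⟨hx, hxC⟩))
    have hreal : β.real (symmDiff C I') ≤ δ / (n + 1) := by
      rw [measureReal_def]
      exact (ENNReal.toReal_le_of_le_ofReal (by positivity) hCI.le)
    have hms : MeasurableSet (symmDiff C I') := hCm.symmDiff hI'm
    calc β.real I' ≤ β.real (I0 ∪ (symmDiff C I' ∪ ⋃ i, sh (FreeGroup.of i) ⁻¹' (symmDiff C I'))) :=
          measureReal_mono hsub
      _ ≤ β.real I0 + (β.real (symmDiff C I') + β.real (⋃ i, sh (FreeGroup.of i) ⁻¹' (symmDiff C I'))) :=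
          (measureReal_union_le _ _).trans (by gcongr; exact measureReal_union_le _ _)
      _ ≤ β.real I0 + (δ / (n + 1) + ∑ _i : Fin n, δ / (n + 1)) := by
          gcongr
          refine (measureReal_iUnion_fintype_le _).trans (Finset.sum_le_sum fun i _ => ?_)
          rw [measureReal_def, (bern_mp hβ _).measure_preimage hms.nullMeasurableSet, ← measureReal_def]
          exact hreal
      _ = _ := by
          simp; field_simp; ring

open Filter in
theorem clopen_eventually {ε : ℝ} (hε : 0 < ε) : ∀ᶠ n : ℕ in atTop,
    ∀ (B : Finset (FreeGroup (Fin n))) (f : (B → Bool) → Bool),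
    (∀ (i : Fin n) (x : FreeGroup (Fin n) → Bool), ¬ (f (rst B x) = true ∧ f (rst B (gens n i x)) = true)) →
    rho f ≤ (1 / 2 + ε) * Real.log n / n := by
  obtain ⟨K, hK2, hKε⟩ : ∃ K : ℝ, 2 ≤ K ∧ 7 * (1 / 2 + ε) ≤ ε * K := by
    refine ⟨max 2 (7 * (1 / 2 + ε) / ε), le_max_left _ _, ?_⟩
    have := le_max_right 2 (7 * (1 / 2 + ε) / ε)
    rw [div_le_iff₀ hε] at this
    linarith
  have hK0 : 0 < K := by linarith
  obtain ⟨k, hk2, hk⟩ : ∃ k : ℕ, 2 * K ≤ k ∧ (1 - (1 / K ^ 3) ^ 2) ^ k ≤ 1 / K := by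
    have ht : 0 < (1 / K ^ 3) ^ 2 := by positivity
    have ht1 : (1 / K ^ 3) ^ 2 ≤ 1 := by
      apply pow_le_one₀ (by positivity)
      rw [div_le_one (by positivity)]
      exact one_le_pow₀ (by linarith)
    have h1 := (tendsto_pow_atTop_nhds_zero_of_lt_one (r := 1 - (1 / K ^ 3) ^ 2) (by linarith) (by linarith)).eventually_le_const
      (show 0 < 1 / K by positivity)
    have h2 := (tendsto_natCast_atTop_atTop (R := ℝ)).eventually_ge_atTop (2 * K)
    obtain ⟨k, hk⟩ := (h1.and h2).exists
    exact ⟨k, hk.2, hk.1⟩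
  have hlog : Tendsto (fun n : ℕ => Real.log n) atTop atTop :=
    Real.tendsto_log_atTop.comp tendsto_natCast_atTop_atTop
  have e1 := hlog.eventually_ge_atTop (1 / (1 / 2 + ε))
  have e2 := hlog.eventually_gt_atTop ((1 + k * Real.log 2) / ε)
  have e3 := (tendsto_natCast_atTop_atTop (R := ℝ)).eventually_ge_atTop (4 * K ^ 2 * (k * Real.log 2))
  filter_upwards [e1, e2, e3, eventually_gt_atTop 1] with n h1 h2 h3 hn1 B f hf
  by_contra hcon
  push Not at hcon
  have hn : (0 : ℝ) < n := by exact_mod_cast (by omega : 0 < n)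
  have hL : 1 ≤ (1 / 2 + ε) * Real.log n := by
    rw [div_le_iff₀ (by positivity)] at h1; linarith
  have hb : 0 < (1 / 2 + ε) * Real.log n / n := by positivity
  set ρ := rho f
  have hρ0 : 0 < ρ := hb.trans hcon
  obtain ⟨c1, c2⟩ := clopen_bound hK2 hk2 hk B f hf hρ0
  have hρK : ρ ≤ 1 / (2 * K) := by
    rw [le_div_iff₀ (by positivity)]
    by_contra h
    push Not at h
    have h4 : 1 < (ρ * (2 * K)) ^ 2 := by nlinarith
    have h5 : (4 * K ^ 2) * (n * ρ ^ 2) ≤ (4 * K ^ 2) * (k * Real.log 2) := mul_le_mul_of_nonneg_left c1 (by positivity)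
    nlinarith
  have c3 := c2 hρK
  have hlogle : Real.log (1 / ρ) ≤ Real.log n := by
    apply Real.log_le_log (by positivity)
    rw [div_le_iff₀ hρ0]
    rw [div_lt_iff₀ hn] at hcon
    linarith
  have hcoef : 1 + ε ≤ (1 / 2 + ε) * (2 - 7 / K) := by
    have : (1 / 2 + ε) * (7 / K) ≤ ε := by
      rw [← mul_div_assoc, div_le_iff₀ hK0]; linarith
    linarith
  have hpos : 0 < 2 - 7 / K := by
    by_contra h
    push Not at h
    nlinarith
  have hbn : (1 / 2 + ε) * Real.log n ≤ n * ρ := by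
    rw [div_lt_iff₀ hn] at hcon; linarith
  have hl0 : 0 < Real.log n := by
    by_contra h
    push Not at h
    nlinarith
  have c4 : (1 + ε) * Real.log n ≤ n * ρ * (2 - 7 / K) := by
    calc (1 + ε) * Real.log n ≤ (1 / 2 + ε) * (2 - 7 / K) * Real.log n := mul_le_mul_of_nonneg_right hcoef hl0.le
      _ = (1 / 2 + ε) * Real.log n * (2 - 7 / K) := by ring
      _ ≤ _ := mul_le_mul_of_nonneg_right hbn hpos.le
  rw [div_lt_iff₀ hε] at h2
  linarith

open Filter in
theorem upper_eventually {ε : ℝ} (hε : 0 < ε) : ∀ᶠ n : ℕ in atTop,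
    ∀ (β : Measure (FreeGroup (Fin n) → Bool)), IsProbabilityMeasure β → IsBernoulliMeasure β →
    ∀ I, NullMeasurableSet I β → I ⊆ freePart (FreeGroup (Fin n)) → IndepIn (freeGroupSchreierAdj n) I →
    β.real I ≤ (1 / 2 + ε) * Real.log n / n := by
  filter_upwards [clopen_eventually hε] with n hn β hp hβ I hI hIf hind
  refine le_of_forall_pos_le_add fun δ hδ => ?_
  have hind' : ∀ i x, ¬ (x ∈ I ∧ sh (FreeGroup.of i) x ∈ I) := by
    rintro i x ⟨h1, h2⟩
    refine hind x h1 _ h2 ⟨hIf h1, hIf h2, ?_, i, Or.inl rfl⟩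
    intro h
    exact hIf h1 (FreeGroup.of i) (FreeGroup.of_ne_one i) h.symm
  obtain ⟨B, f, hf, hle⟩ := approx_cyl hβ hI hind' hδ
  have := hn B f hf
  linarith

set_option linter.unusedSectionVars false

section Dep
variable {Γ : Type*}

theorem DepOn.mono {J : Set (Γ → Bool)} {B C : Set Γ} (h : DepOn J B) (hBC : B ⊆ C) : DepOn J C :=
  fun x y hxy hx => h x y (fun b hb => hxy b (hBC hb)) hx

theorem DepOn.exists_fin [DecidableEq Γ] {J : Set (Γ → Bool)} {B : Set Γ} (h : DepOn J B) (hB : B.Finite) :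
    ∃ (B' : Finset Γ) (f : (B' → Bool) → Bool), (B' : Set Γ) = B ∧ ∀ x, x ∈ J ↔ f (rst B' x) = true := by
  have h' : DepOn J (hB.toFinset : Set Γ) := by rwa [hB.coe_toFinset]
  obtain ⟨f, hf⟩ := h'.exists_f
  exact ⟨_, f, hB.coe_toFinset, hf⟩

theorem DepOn.meas {J : Set (Γ → Bool)} {B : Set Γ} (h : DepOn J B) (hB : B.Finite) : MeasurableSet J := by
  classical
  obtain ⟨B', f, _, hf⟩ := h.exists_fin hB
  have : J = (f ∘ rst B') ⁻¹' {true} := by ext x; simp [hf]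
  rw [this]
  exact (FM_rst B').comp f true

variable [Group Γ] {β : Measure (Γ → Bool)} [IsProbabilityMeasure β]

theorem indep_two (hβ : IsBernoulliMeasure β) {J J' : Set (Γ → Bool)} {B B' : Set Γ}
    (h : DepOn J B) (hB : B.Finite) (h' : DepOn J' B') (hB' : B'.Finite) (hd : Disjoint B B') :
    β.real (J ∩ J') = β.real J * β.real J' := by
  classical
  obtain ⟨ν, hν, hu⟩ := exists_unif
  obtain ⟨B1, f, rfl, hf⟩ := h.exists_fin hB
  obtain ⟨B2, f', rfl, hf'⟩ := h'.exists_fin hB'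
  have hi : ProbabilityTheory.iIndepFun (fun (i : Γ) (ω : Γ → Bool) => ω i) β := by
    rw [bern_eq hβ hu]
    exact ProbabilityTheory.iIndepFun_infinitePi (X := fun _ ω => ω) (by fun_prop)
  have h2 := hi.indepFun_finset B1 B2 (by exact_mod_cast hd) (by fun_prop)
  have h3 := h2.measure_inter_preimage_eq_mul {z | f z = true} {z | f' z = true}
    (Set.toFinite _).measurableSet (Set.toFinite _).measurableSet
  have e1 : J = (fun a (i : B1) => a i) ⁻¹' {z | f z = true} := by ext x; exact hf x
  have e2 : J' = (fun a (i : B2) => a i) ⁻¹' {z | f' z = true} := by ext x; exact hf' x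
  rw [← e1, ← e2] at h3
  simp only [measureReal_def, h3, ENNReal.toReal_mul]

theorem indep_multi (hβ : IsBernoulliMeasure β) {ι : Type*} (F : Finset ι) (J : ι → Set (Γ → Bool)) (B : ι → Set Γ)
    (h : ∀ i ∈ F, DepOn (J i) (B i)) (hB : ∀ i ∈ F, (B i).Finite)
    (hd : ∀ i ∈ F, ∀ j ∈ F, i ≠ j → Disjoint (B i) (B j)) :
    β.real {x | ∀ i ∈ F, x ∈ J i} = ∏ i ∈ F, β.real (J i) := by
  classical
  induction F using Finset.induction_on with
  | empty => simp
  | insert a F ha ih =>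
    rw [Finset.prod_insert ha, ← ih (fun i hi => h i (Finset.mem_insert_of_mem hi))
      (fun i hi => hB i (Finset.mem_insert_of_mem hi))
      (fun i hi j hj => hd i (Finset.mem_insert_of_mem hi) j (Finset.mem_insert_of_mem hj))]
    rw [← indep_two hβ (h a (Finset.mem_insert_self a F)) (hB a (Finset.mem_insert_self a F))
      (B' := ⋃ i ∈ F, B i)]
    · congr 1
      ext x; simp
    · intro x y hxy hx i hi
      refine h i (Finset.mem_insert_of_mem hi) x y (fun b hb => hxy b ?_) (hx i hi)
      exact Set.mem_biUnion hi hb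
    · exact F.finite_toSet.biUnion (fun i hi => hB i (Finset.mem_insert_of_mem hi))
    · rw [Set.disjoint_iUnion₂_right]
      intro i hi
      exact hd a (Finset.mem_insert_self a F) i (Finset.mem_insert_of_mem hi) (by rintro rfl; exact ha hi)
end Dep

section Greedy
variable {n : ℕ}

def KK (L : (FreeGroup (Fin n) → Bool) → ℕ) (t : ℕ) (s : Fin n × Bool) (x : FreeGroup (Fin n) → Bool) : Prop :=
  L x = t ∧ ∀ s', s' ≠ s → ∀ t', (h : t' < t) → ¬ KK L t' (linv s') (sh (ltr s') x)
termination_by t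

def ZZ (L : (FreeGroup (Fin n) → Bool) → ℕ) (t : ℕ) (s' : Fin n × Bool) : Set (FreeGroup (Fin n) → Bool) :=
  {x | ∀ t', t' < t → ¬ KK L t' (linv s') (sh (ltr s') x)}

theorem KK_iff (L : (FreeGroup (Fin n) → Bool) → ℕ) (t : ℕ) (s : Fin n × Bool) (x : FreeGroup (Fin n) → Bool) :
    KK L t s x ↔ L x = t ∧ ∀ s', s' ≠ s → x ∈ ZZ L t s' := by
  rw [KK]; rfl

def II (L : (FreeGroup (Fin n) → Bool) → ℕ) : Set (FreeGroup (Fin n) → Bool) :=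
  {x | ∀ s', x ∈ ZZ L (L x + 1) s'}

theorem II_indep_aux (L : (FreeGroup (Fin n) → Bool) → ℕ) (x : FreeGroup (Fin n) → Bool) (s : Fin n × Bool)
    (hx : x ∈ II L) (hy : sh (ltr s) x ∈ II L) (h : L (sh (ltr s) x) ≤ L x) : False := by
  refine hx s (L (sh (ltr s) x)) (by omega) ?_
  rw [KK_iff]
  refine ⟨rfl, fun s' _ t' ht' => hy s' t' (by omega)⟩

theorem II_indep (L : (FreeGroup (Fin n) → Bool) → ℕ) (x : FreeGroup (Fin n) → Bool) (s : Fin n × Bool)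
    (hx : x ∈ II L) (hy : sh (ltr s) x ∈ II L) : False := by
  rcases le_total (L (sh (ltr s) x)) (L x) with h | h
  · exact II_indep_aux L x s hx hy h
  · have e : sh (ltr (linv s)) (sh (ltr s) x) = x := by
      rw [sh_sh, ltr_linv, inv_mul_cancel]; funext δ; simp [sh]
    refine II_indep_aux L (sh (ltr s) x) (linv s) hy ?_ ?_ <;> rw [e] <;> assumption

def CC (T : Finset (FreeGroup (Fin n))) (t : ℕ) (s : Fin n × Bool) : Set (FreeGroup (Fin n)) :=
  {γ | ∃ τ ∈ T, ∃ g : FreeGroup (Fin n), γ = τ * g ∧ g.norm ≤ t ∧ g.norm < (g * ltr (linv s)).norm}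

def EE (T : Finset (FreeGroup (Fin n))) (t : ℕ) (s : Fin n × Bool) : Set (FreeGroup (Fin n)) :=
  {γ | ∃ τ ∈ T, ∃ g : FreeGroup (Fin n), γ = τ * g ∧ g.norm ≤ t ∧ (g * ltr (linv s)).norm < g.norm}

theorem ball_finite (t : ℕ) : {g : FreeGroup (Fin n) | g.norm ≤ t}.Finite :=
  Set.Finite.preimage (FreeGroup.toWord_injective.injOn) (List.finite_length_le (Fin n × Bool) t)

theorem ball_mul_finite (T : Finset (FreeGroup (Fin n))) (t : ℕ) :
    {γ | ∃ τ ∈ T, ∃ g : FreeGroup (Fin n), γ = τ * g ∧ g.norm ≤ t}.Finite := by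
  refine (T.finite_toSet.image2 (fun τ g => τ * g) (ball_finite t)).subset ?_
  rintro γ ⟨τ, hτ, g, rfl, hg⟩
  exact ⟨τ, hτ, g, hg, rfl⟩

theorem CC_finite (T : Finset (FreeGroup (Fin n))) (t : ℕ) (s : Fin n × Bool) : (CC T t s).Finite :=
  (ball_mul_finite T t).subset fun _ ⟨τ, hτ, g, h1, h2, _⟩ => ⟨τ, hτ, g, h1, h2⟩

theorem EE_finite (T : Finset (FreeGroup (Fin n))) (t : ℕ) (s : Fin n × Bool) : (EE T t s).Finite :=
  (ball_mul_finite T t).subset fun _ ⟨τ, hτ, g, h1, h2, _⟩ => ⟨τ, hτ, g, h1, h2⟩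

variable {L : (FreeGroup (Fin n) → Bool) → ℕ} {T : Finset (FreeGroup (Fin n))}
  (hL : ∀ x y : FreeGroup (Fin n) → Bool, (∀ b ∈ T, x b = y b) → L x = L y)

theorem ZZ_dep_of {t : ℕ} (s : Fin n × Bool)
    (h : ∀ t' < t, DepOn {x | KK L t' (linv s) x} (CC T t' (linv s))) : DepOn (ZZ L t s) (EE T t s) := by
  intro x y hxy hx t' ht' hy
  refine hx t' ht' (h t' ht' _ _ ?_ hy)
  rintro b ⟨τ, hτ, g, rfl, h1, h2⟩
  rw [linv_linv] at h2
  unfold sh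
  refine (hxy _ ⟨τ, hτ, g * ltr s, by rw [mul_assoc], ?_, ?_⟩).symm
  · rcases norm_mul_ltr_cases g s with h | h <;> omega
  · rw [ltr_linv, mul_inv_cancel_right]; exact h2

include hL in
theorem KK_dep (t : ℕ) : ∀ s, DepOn {x | KK L t s x} (CC T t s) := by
  induction t using Nat.strong_induction_on with
  | _ t ih =>
    intro s x y hxy hx
    rw [Set.mem_ofPred_eq, KK_iff] at hx ⊢
    refine ⟨?_, fun s' hs' => ?_⟩
    · rw [← hx.1]
      refine (hL x y fun b hb => hxy b ⟨b, hb, 1, by simp, by simp, ?_⟩).symm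
      rcases norm_mul_ltr_cases (1 : FreeGroup (Fin n)) (linv s) with h | h
      · omega
      · simp at h
    · refine ZZ_dep_of (T := T) s' (fun t' ht' => ih t' ht' _) x y (fun b hb => hxy b ?_) (hx.2 s' hs')
      obtain ⟨τ, hτ, g, rfl, h1, h2⟩ := hb
      refine ⟨τ, hτ, g, rfl, h1, ?_⟩
      rcases norm_mul_ltr_cases g (linv s) with h | h
      · omega
      · exfalso
        apply hs'
        have := norm_mul_ltr_unique h2 (show (g * ltr (linv s)).norm < g.norm by omega)
        rw [← linv_linv s', this, linv_linv]

include hL in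
theorem ZZ_dep (t : ℕ) (s : Fin n × Bool) : DepOn (ZZ L t s) (EE T t s) :=
  ZZ_dep_of s fun t' _ => KK_dep hL t' _

noncomputable def PP (N d : ℕ) : ℕ → ℝ
  | 0 => 0
  | t + 1 => PP N d t + 1 / N * (1 - PP N d t) ^ (d - 1)

variable {N : ℕ} {β : Measure (FreeGroup (Fin n) → Bool)} [IsProbabilityMeasure β] (hβ : IsBernoulliMeasure β)
  (hLN : ∀ x, L x < N) (hLβ : ∀ t < N, β.real {x | L x = t} = 1 / N)
  (hinj : ∀ τ ∈ T, ∀ τ' ∈ T, ∀ g g' : FreeGroup (Fin n), g.norm ≤ N → g'.norm ≤ N → τ * g = τ' * g' → g = g')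

include hL hβ in
theorem ZZ_real_of {t : ℕ} (s : Fin n × Bool)
    (h : ∀ t' < t, β.real {x | KK L t' (linv s) x} = PP N (2 * n) (t' + 1) - PP N (2 * n) t') :
    β.real (ZZ L t s) = 1 - PP N (2 * n) t := by
  have e : (ZZ L t s)ᶜ = ⋃ t' ∈ Finset.range t, sh (ltr s) ⁻¹' {x | KK L t' (linv s) x} := by
    ext x; simp [ZZ]
  have hm : ∀ t' , MeasurableSet {x | KK L t' (linv s) x} := fun t' => (KK_dep hL t' _).meas (CC_finite _ _ _)
  have hmz : MeasurableSet (ZZ L t s) := (ZZ_dep hL t s).meas (EE_finite _ _ _)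
  have h1 := probReal_compl_eq_one_sub (μ := β) hmz
  rw [e, measureReal_biUnion_finset] at h1
  · have h2 : ∀ t' ∈ Finset.range t, β.real (sh (ltr s) ⁻¹' {x | KK L t' (linv s) x}) =
        PP N (2 * n) (t' + 1) - PP N (2 * n) t' := by
      intro t' ht'
      rw [measureReal_def, (bern_mp hβ _).measure_preimage (hm t').nullMeasurableSet, ← measureReal_def]
      exact h t' (Finset.mem_range.1 ht')
    rw [Finset.sum_congr rfl h2, Finset.sum_range_sub] at h1
    have : PP N (2 * n) 0 = 0 := rfl
    linarith
  · intro a _ b _ hab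
    refine Set.disjoint_left.2 fun x hx hx' => hab ?_
    rw [Set.mem_preimage, Set.mem_ofPred_eq, KK_iff] at hx hx'
    rw [← hx.1, hx'.1]
  · intro t' _
    exact (bern_mp hβ (ltr s)).measurable (hm t')

include hL hβ hLβ hinj in
theorem level_real {t u : ℕ} (ht : t < N) (hu : u ≤ N) (F : Finset (Fin n × Bool))
    (h : ∀ s ∈ F, β.real (ZZ L u s) = 1 - PP N (2 * n) u) :
    β.real {x | L x = t ∧ ∀ s ∈ F, x ∈ ZZ L u s} = 1 / N * (1 - PP N (2 * n) u) ^ F.card := by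
  classical
  have hm := indep_multi hβ F (fun s => ZZ L u s) (fun s => EE T u s)
    (fun s _ => ZZ_dep hL u s) (fun s _ => EE_finite _ _ _) (by
      intro s _ s' _ hss
      refine Set.disjoint_left.2 ?_
      rintro γ ⟨τ, hτ, g, rfl, h1, h2⟩ ⟨τ', hτ', g', he, h1', h2'⟩
      obtain rfl := hinj τ hτ τ' hτ' g g' (by omega) (by omega) he
      apply hss
      have := norm_mul_ltr_unique h2 h2'
      rw [← linv_linv s, this, linv_linv])
  rw [Finset.prod_congr rfl h, Finset.prod_const] at hm
  rw [← hm, ← hLβ t ht]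
  rw [← indep_two hβ (J := {x | L x = t}) (B := (T : Set (FreeGroup (Fin n)))) (B' := ⋃ s ∈ F, EE T u s)]
  · rfl
  · intro x y hxy hx
    rw [Set.mem_ofPred_eq] at hx ⊢
    rw [← hx]
    exact (hL x y fun b hb => hxy b hb).symm
  · exact T.finite_toSet
  · intro x y hxy hx s hs
    exact ZZ_dep hL u s x y (fun b hb => hxy b (Set.mem_biUnion (show s ∈ (F : Set _) from hs) hb)) (hx s hs)
  · exact F.finite_toSet.biUnion (fun s _ => EE_finite _ _ _)
  · rw [Set.disjoint_iUnion₂_right]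
    intro s _
    refine Set.disjoint_left.2 ?_
    rintro γ hγ ⟨τ', hτ', g', he, h1', h2'⟩
    have := hinj γ hγ τ' hτ' 1 g' (by simp) (by omega) (by simpa using he)
    rw [← this] at h2'
    simp at h2'

include hL hβ hLβ hinj in
theorem KK_real (t : ℕ) : t < N → ∀ s, β.real {x | KK L t s x} = PP N (2 * n) (t + 1) - PP N (2 * n) t := by
  classical
  induction t using Nat.strong_induction_on with
  | _ t ih =>
    intro ht s
    have := level_real hL hβ hLβ hinj ht ht.le (Finset.univ.erase s) (fun s' _ =>
      ZZ_real_of (N := N) hL hβ s' (fun t' ht' => ih t' ht' (by omega) _))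
    have e : {x | KK L t s x} = {x | L x = t ∧ ∀ s' ∈ Finset.univ.erase s, x ∈ ZZ L t s'} := by
      ext x; simp [KK_iff]
    rw [e, this, PP, Finset.card_erase_of_mem (Finset.mem_univ _)]
    simp [mul_comm 2 n]

include hL hβ hLN hLβ hinj in
theorem II_real : MeasurableSet (II L) ∧
    β.real (II L) = ∑ t ∈ Finset.range N, 1 / N * (1 - PP N (2 * n) (t + 1)) ^ (2 * n) := by
  classical
  have e : II L = ⋃ t ∈ Finset.range N, {x | L x = t ∧ ∀ s ∈ Finset.univ, x ∈ ZZ L (t + 1) s} := by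
    ext x
    simp only [II, Set.mem_ofPred_eq, Set.mem_iUnion, Finset.mem_range, Finset.mem_univ, true_imp_iff, exists_prop]
    constructor
    · intro h; exact ⟨L x, hLN x, rfl, h⟩
    · rintro ⟨t, _, rfl, h⟩; exact h
  have hm : ∀ t, MeasurableSet {x | L x = t ∧ ∀ s ∈ Finset.univ, x ∈ ZZ L (t + 1) s} := by
    intro t
    have e2 : {x | L x = t ∧ ∀ s ∈ Finset.univ, x ∈ ZZ L (t + 1) s} = {x | L x = t} ∩ ⋂ s, ZZ L (t + 1) s := by
      ext x; simp
    rw [e2]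
    refine MeasurableSet.inter ?_ (MeasurableSet.iInter fun s => (ZZ_dep hL _ s).meas (EE_finite _ _ _))
    refine DepOn.meas (B := (T : Set (FreeGroup (Fin n)))) ?_ T.finite_toSet
    intro x y hxy hx
    rw [Set.mem_ofPred_eq] at hx ⊢
    rw [← hx]
    exact (hL x y fun b hb => hxy b hb).symm
  rw [e]
  refine ⟨Finset.measurableSet_biUnion _ fun t _ => hm t, ?_⟩
  rw [measureReal_biUnion_finset]
  · refine Finset.sum_congr rfl fun t ht => ?_
    have ht' := Finset.mem_range.1 ht
    rw [level_real hL hβ hLβ hinj ht' (show t + 1 ≤ N by omega) Finset.univ (fun s _ =>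
      ZZ_real_of (N := N) hL hβ s (fun t' h' => KK_real hL hβ hLβ hinj t' (by omega) _))]
    simp [mul_comm 2 n]
  · intro a _ b _ hab
    exact Set.disjoint_left.2 fun x hx hx' => hab (hx.1.symm.trans hx'.1)
  · exact fun t _ => hm t

end Greedy

theorem PP_bounds {N d : ℕ} (hN : 1 ≤ N) (hd : 2 ≤ d) (t : ℕ) : 0 ≤ PP N d t ∧ PP N d t ≤ 1 := by
  have hN' : (1 : ℝ) ≤ N := by exact_mod_cast hN
  have hi : 1 / (N : ℝ) ≤ 1 := by rw [div_le_one (by positivity)]; exact hN'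
  have hi0 : 0 ≤ 1 / (N : ℝ) := by positivity
  induction t with
  | zero => simp [PP]
  | succ t ih =>
    rw [PP]
    have h1 : 0 ≤ 1 - PP N d t := by linarith [ih.2]
    have h2 : (1 - PP N d t) ^ (d - 1) ≤ 1 - PP N d t :=
      pow_le_of_le_one h1 (by linarith [ih.1]) (by omega)
    have h3 := pow_nonneg h1 (d - 1)
    constructor
    · have := mul_nonneg hi0 h3; linarith [ih.1]
    · have := mul_le_mul hi h2 h3 zero_le_one
      linarith

theorem PP_mono {N d : ℕ} (hN : 1 ≤ N) (hd : 2 ≤ d) : Monotone (PP N d) := by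
  refine monotone_nat_of_le_succ fun t => ?_
  rw [PP]
  have h1 : 0 ≤ 1 - PP N d t := by linarith [(PP_bounds hN hd t).2]
  have : 0 ≤ 1 / (N : ℝ) * (1 - PP N d t) ^ (d - 1) := by positivity
  linarith

theorem PP_ge {N d : ℕ} (hN : 1 ≤ N) (hd : 2 ≤ d) {c : ℝ} (hc1 : c ≤ 1) (hc : c ≤ (1 - c) ^ (d - 1)) :
    c ≤ PP N d N := by
  by_contra hcon
  push Not at hcon
  have hN' : (0 : ℝ) < N := by exact_mod_cast hN
  have : ∀ t, t ≤ N → t * (c / N) ≤ PP N d t := by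
    intro t
    induction t with
    | zero => intro _; simp [PP]
    | succ t ih =>
      intro ht
      have h1 := ih (by omega)
      have h2 : PP N d t < c := lt_of_le_of_lt (PP_mono hN hd (by omega)) hcon
      have h3 : (1 - c) ^ (d - 1) ≤ (1 - PP N d t) ^ (d - 1) :=
        pow_le_pow_left₀ (by linarith) (by linarith) _
      have h4 : 1 / (N : ℝ) * c ≤ 1 / N * (1 - PP N d t) ^ (d - 1) :=
        mul_le_mul_of_nonneg_left (hc.trans h3) (by positivity)
      rw [PP]; push_cast
      have e : 1 / (N : ℝ) * c = c / N := by ring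
      linarith
  have h := this N le_rfl
  rw [mul_div_cancel₀ _ hN'.ne'] at h
  linarith

theorem PP_sum {N d : ℕ} (hN : 1 ≤ N) (hd : 2 ≤ d) :
    (1 - d / N) * (PP N d N - PP N d N ^ 2 / 2) ≤ ∑ t ∈ Finset.range N, 1 / N * (1 - PP N d (t + 1)) ^ d := by
  have hN' : (1 : ℝ) ≤ N := by exact_mod_cast hN
  have hi : 1 / (N : ℝ) ≤ 1 := by rw [div_le_one (by positivity)]; exact hN'
  have hi0 : 0 ≤ 1 / (N : ℝ) := by positivity
  have hb := PP_bounds hN hd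
  have h1 : (1 - d / N : ℝ) ≤ (1 - 1 / N) ^ d := by
    have := one_add_mul_le_pow (show (-2 : ℝ) ≤ - (1 / N) by linarith) d
    calc (1 - d / N : ℝ) = 1 + d * (-(1 / N)) := by ring
      _ ≤ _ := this
      _ = _ := by ring
  have h2 : PP N d N - PP N d N ^ 2 / 2 = ∑ t ∈ Finset.range N,
      ((PP N d (t + 1) - PP N d (t + 1) ^ 2 / 2) - (PP N d t - PP N d t ^ 2 / 2)) := by
    rw [Finset.sum_range_sub (fun t => PP N d t - PP N d t ^ 2 / 2)]
    simp [PP]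
  have h0 : 0 ≤ PP N d N - PP N d N ^ 2 / 2 := by nlinarith [hb N]
  refine (mul_le_mul_of_nonneg_right h1 h0).trans ?_
  rw [h2, Finset.mul_sum]
  refine Finset.sum_le_sum fun t _ => ?_
  have hq0 : 0 ≤ 1 - PP N d t := by linarith [(hb t).2]
  have hq1 : 1 - PP N d t ≤ 1 := by linarith [(hb t).1]
  have e1 : PP N d (t + 1) - PP N d t = 1 / N * (1 - PP N d t) ^ (d - 1) := by rw [PP]; ring
  have hinc : 0 ≤ PP N d (t + 1) - PP N d t := by rw [e1]; positivity
  have h3 : (1 - 1 / (N : ℝ)) * (1 - PP N d t) ≤ 1 - PP N d (t + 1) := by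
    have : (1 - PP N d t) ^ (d - 1) ≤ 1 - PP N d t := pow_le_of_le_one hq0 hq1 (by omega)
    have := mul_le_mul_of_nonneg_left this hi0
    linarith
  have h4 := pow_le_pow_left₀ (mul_nonneg (by linarith) hq0) h3 d
  rw [mul_pow] at h4
  have h5 := mul_le_mul_of_nonneg_left h4 hi0
  refine le_trans ?_ h5
  have h6 : (PP N d (t + 1) - PP N d (t + 1) ^ 2 / 2) - (PP N d t - PP N d t ^ 2 / 2) ≤
      1 / N * (1 - PP N d t) ^ d := by
    have e2 : 1 / (N : ℝ) * (1 - PP N d t) ^ d = (PP N d (t + 1) - PP N d t) * (1 - PP N d t) := by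
      rw [e1, mul_assoc, ← pow_succ]
      congr 2; omega
    rw [e2]; nlinarith
  have h7 : 0 ≤ (1 - 1 / (N : ℝ)) ^ d := pow_nonneg (by linarith) d
  calc _ ≤ (1 - 1 / (N : ℝ)) ^ d * (1 / N * (1 - PP N d t) ^ d) := mul_le_mul_of_nonneg_left h6 h7
    _ = _ := by ring

set_option linter.unusedSectionVars false

section Lower
variable {n : ℕ}

def tauj (i0 : Fin n) (K : ℕ) (j : ℕ) : FreeGroup (Fin n) := FreeGroup.of i0 ^ ((2 * K + 1) * j)

theorem tauj_lt (i0 : Fin n) (K : ℕ) {i j : ℕ} (hij : i < j) (g g' : FreeGroup (Fin n))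
    (hg : g.norm ≤ K) (hg' : g'.norm ≤ K) (h : tauj i0 K i * g = tauj i0 K j * g') : False := by
  obtain ⟨k, rfl⟩ : ∃ k, j = i + (k + 1) := ⟨j - i - 1, by omega⟩
  have h1 : FreeGroup.of i0 ^ ((2 * K + 1) * (k + 1)) = g * g'⁻¹ := by
    have : tauj i0 K (i + (k + 1)) = tauj i0 K i * FreeGroup.of i0 ^ ((2 * K + 1) * (k + 1)) := by
      unfold tauj; rw [← pow_add, mul_add]
    rw [this, mul_assoc] at h
    have := mul_left_cancel h
    rw [this]; group
  have h2 : (2 * K + 1) * (k + 1) ≤ K + K := by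
    calc (2 * K + 1) * (k + 1) = (FreeGroup.of i0 ^ ((2 * K + 1) * (k + 1))).norm := (FreeGroup.norm_of_pow _ _).symm
      _ = (g * g'⁻¹).norm := by rw [h1]
      _ ≤ g.norm + g'⁻¹.norm := FreeGroup.norm_mul_le _ _
      _ ≤ K + K := by rw [FreeGroup.norm_inv_eq]; omega
  nlinarith [Nat.zero_le (K * k)]

theorem tauj_inj (i0 : Fin n) (K : ℕ) {i j : ℕ} (g g' : FreeGroup (Fin n))
    (hg : g.norm ≤ K) (hg' : g'.norm ≤ K) (h : tauj i0 K i * g = tauj i0 K j * g') : i = j ∧ g = g' := by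
  rcases lt_trichotomy i j with hij | rfl | hij
  · exact (tauj_lt i0 K hij g g' hg hg' h).elim
  · exact ⟨rfl, mul_left_cancel h⟩
  · exact (tauj_lt i0 K hij g' g hg' hg h.symm).elim

theorem tauj_inj' (i0 : Fin n) (K : ℕ) : Function.Injective (tauj i0 K) := by
  intro i j h
  exact (tauj_inj i0 K 1 1 (by simp) (by simp) (by rw [h])).1

noncomputable def eM (M : ℕ) : (Fin M → Bool) ≃ Fin (2 ^ M) :=
  Fintype.equivFinOfCardEq (by simp)

theorem exists_II (i0 : Fin n) (M : ℕ) {β : Measure (FreeGroup (Fin n) → Bool)} [IsProbabilityMeasure β]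
    (hβ : IsBernoulliMeasure β) :
    ∃ L : (FreeGroup (Fin n) → Bool) → ℕ, MeasurableSet (II L) ∧
    β.real (II L) = ∑ t ∈ Finset.range (2 ^ M), 1 / ((2 ^ M : ℕ) : ℝ) * (1 - PP (2 ^ M) (2 * n) (t + 1)) ^ (2 * n) := by
  classical
  set T : Finset (FreeGroup (Fin n)) := Finset.univ.image (fun j : Fin M => tauj i0 (2 ^ M) j) with hT
  have hinj0 : Function.Injective (fun j : Fin M => tauj i0 (2 ^ M) j) :=
    (tauj_inj' i0 (2 ^ M)).comp Fin.val_injective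
  have hcard : T.card = M := by
    rw [hT, Finset.card_image_of_injective _ hinj0]; simp
  refine ⟨fun x => (eM M fun j => x (tauj i0 (2 ^ M) j)).val, ?_⟩
  refine II_real (T := T) (N := 2 ^ M) ?_ hβ ?_ ?_ ?_
  · intro x y h
    have : (fun j : Fin M => x (tauj i0 (2 ^ M) j)) = fun j : Fin M => y (tauj i0 (2 ^ M) j) := by
      funext j
      exact h _ (Finset.mem_image_of_mem _ (Finset.mem_univ j))
    simp only [this]
  · intro x; exact (eM M _).isLt
  · intro t ht
    set a := (eM M).symm ⟨t, ht⟩ with ha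
    have key : {x : FreeGroup (Fin n) → Bool | (eM M fun j => x (tauj i0 (2 ^ M) j)).val = t} =
        {x | ∀ δ ∈ T, x δ = Function.extend (fun j : Fin M => tauj i0 (2 ^ M) j) a (fun _ => false) δ} := by
      ext x
      simp only [Set.mem_ofPred_eq]
      have h1 : (eM M fun j => x (tauj i0 (2 ^ M) j)).val = t ↔ (fun j : Fin M => x (tauj i0 (2 ^ M) j)) = a := by
        rw [ha, Equiv.eq_symm_apply, Fin.ext_iff]
      rw [h1]
      constructor
      · intro h δ hδ
        obtain ⟨j, _, rfl⟩ := Finset.mem_image.1 hδ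
        rw [hinj0.extend_apply]
        exact congrFun h j
      · intro h
        funext j
        have := h _ (Finset.mem_image_of_mem _ (Finset.mem_univ j))
        rwa [hinj0.extend_apply] at this
    rw [key, measureReal_def, hβ, hcard]
    simp
  · intro τ hτ τ' hτ' g g' hg hg' h
    obtain ⟨i, _, rfl⟩ := Finset.mem_image.1 hτ
    obtain ⟨j, _, rfl⟩ := Finset.mem_image.1 hτ'
    exact (tauj_inj i0 (2 ^ M) g g' hg hg' h).2

theorem fix_null {β : Measure (FreeGroup (Fin n) → Bool)} [IsProbabilityMeasure β]
    (hβ : IsBernoulliMeasure β) (γ : FreeGroup (Fin n)) (hγ : γ ≠ 1) :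
    β {x | bernoulliShift γ x = x} = 0 := by
  classical
  have hinj : Function.Injective (fun i : ℕ => γ ^ i) := injective_pow_iff_not_isOfFinOrder.2 (by
    rwa [isOfFinOrder_iff_eq_one])
  have hb : ∀ m : ℕ, β {x | bernoulliShift γ x = x} ≤ 2 * (1 / 2 : ENNReal) ^ m := by
    intro m
    set D := (Finset.range m).image (fun i : ℕ => γ ^ i)
    have hD : D.card = m := by
      rw [Finset.card_image_of_injective _ hinj]; simp
    have hsub : {x | bernoulliShift γ x = x} ⊆ {x | ∀ δ ∈ D, x δ = true} ∪ {x | ∀ δ ∈ D, x δ = false} := by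
      intro x hx
      have h1 : ∀ i : ℕ, x (γ ^ i) = x 1 := by
        intro i
        induction i with
        | zero => simp
        | succ i ih =>
          rw [← ih, pow_succ]
          exact congrFun hx (γ ^ i)
      cases h : x 1
      · right
        intro δ hδ
        obtain ⟨i, _, rfl⟩ := Finset.mem_image.1 hδ
        simp only [h1, h]
      · left
        intro δ hδ
        obtain ⟨i, _, rfl⟩ := Finset.mem_image.1 hδ
        simp only [h1, h]
    calc _ ≤ _ := measure_mono hsub
      _ ≤ _ := measure_union_le _ _
      _ = _ := by
        have h1 := hβ D (fun _ => true)
        have h2 := hβ D (fun _ => false)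
        rw [hD] at h1 h2
        rw [h1, h2, two_mul]
  have ht : Filter.Tendsto (fun m : ℕ => 2 * (1 / 2 : ENNReal) ^ m) Filter.atTop (nhds (2 * 0)) := by
    refine ENNReal.Tendsto.const_mul (ENNReal.tendsto_pow_atTop_nhds_zero_of_lt_one ?_) (by simp)
    simp
  rw [mul_zero] at ht
  exact le_antisymm (ge_of_tendsto' ht hb) zero_le

theorem free_ae {β : Measure (FreeGroup (Fin n) → Bool)} [IsProbabilityMeasure β]
    (hβ : IsBernoulliMeasure β) : ∀ᵐ x ∂β, x ∈ freePart (FreeGroup (Fin n)) := by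
  have : Countable (FreeGroup (Fin n)) := by
    unfold FreeGroup; infer_instance
  have h : ∀ᵐ x ∂β, ∀ γ : FreeGroup (Fin n), γ ≠ 1 → bernoulliShift γ x ≠ x := by
    rw [ae_all_iff]
    intro γ
    by_cases hγ : γ = 1
    · simp [hγ]
    · have := fix_null hβ γ hγ
      filter_upwards [measure_eq_zero_iff_ae_notMem.1 this] with x hx _
      exact hx
  exact h

theorem exists_indep (hn : 1 ≤ n) (M : ℕ) {β : Measure (FreeGroup (Fin n) → Bool)} [IsProbabilityMeasure β]
    (hβ : IsBernoulliMeasure β) :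
    ∃ I : Set (FreeGroup (Fin n) → Bool), NullMeasurableSet I β ∧ I ⊆ freePart (FreeGroup (Fin n)) ∧
      IndepIn (freeGroupSchreierAdj n) I ∧
      β.real I = ∑ t ∈ Finset.range (2 ^ M), 1 / ((2 ^ M : ℕ) : ℝ) * (1 - PP (2 ^ M) (2 * n) (t + 1)) ^ (2 * n) := by
  obtain ⟨L, hm, hr⟩ := exists_II (n := n) ⟨0, hn⟩ M hβ
  have hae : (II L ∩ freePart (FreeGroup (Fin n)) : Set _) =ᵐ[β] II L := by
    filter_upwards [free_ae hβ] with x hx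
    exact propext ⟨fun h => h.1, fun h => ⟨h, hx⟩⟩
  refine ⟨II L ∩ freePart _, hm.nullMeasurableSet.congr hae.symm, Set.inter_subset_right, ?_, ?_⟩
  · rintro x hx y hy ⟨_, _, _, i, rfl | rfl⟩
    · exact II_indep L x (i, true) hx.1 (by rw [ltr_true]; exact hy.1)
    · exact II_indep L x (i, false) hx.1 (by rw [ltr_false]; exact hy.1)
  · rw [← hr, measureReal_def, measure_congr hae, measureReal_def]

end Lower

set_option linter.unusedSectionVars false

open Filter in
theorem lower_num {ε : ℝ} (hε : 0 < ε) (hε1 : ε < 1) : ∀ᶠ d : ℕ in atTop, 2 ≤ d ∧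
    (1 - ε) ^ 3 * (Real.log d / d) ≤
      ∑ t ∈ Finset.range (2 ^ (2 * d)), 1 / ((2 ^ (2 * d) : ℕ) : ℝ) * (1 - PP (2 ^ (2 * d)) d (t + 1)) ^ d := by
  have e1 : ∀ᶠ d : ℕ in atTop, Real.log d ≤ (d : ℝ) ^ (ε / 2) := by
    have h := ((isLittleO_log_rpow_atTop (half_pos hε)).bound one_pos)
    filter_upwards [tendsto_natCast_atTop_atTop.eventually h, eventually_ge_atTop 1] with d hd hd1
    rw [one_mul, Real.norm_eq_abs, Real.norm_eq_abs, abs_of_nonneg (a := (d : ℝ) ^ (ε / 2)) (by positivity)] at hd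
    exact (le_abs_self _).trans hd
  have e2 : ∀ᶠ d : ℕ in atTop, Real.log d ≤ ε / 2 * d := by
    have h := (Real.isLittleO_log_id_atTop.bound (half_pos hε))
    filter_upwards [tendsto_natCast_atTop_atTop.eventually h] with d hd
    simp only [id, Real.norm_eq_abs, Nat.abs_cast] at hd
    exact (le_abs_self _).trans hd
  have e3 : ∀ᶠ d : ℕ in atTop, 1 / ε ≤ (d : ℝ) := tendsto_natCast_atTop_atTop.eventually_ge_atTop _
  filter_upwards [e1, e2, e3, eventually_ge_atTop 2] with d h1 h2 h3 hd
  refine ⟨hd, ?_⟩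
  have hd0 : (2 : ℝ) ≤ d := by exact_mod_cast hd
  have hdp : (0 : ℝ) < d := by linarith
  have hlog : 0 ≤ Real.log d := Real.log_nonneg (by linarith)
  set c := (1 - ε) * (Real.log d / d) with hc
  have hq : Real.log d / d ≤ ε / 2 := by rw [div_le_iff₀ hdp]; exact h2
  have hq0 : 0 ≤ Real.log d / d := by positivity
  have hc0 : 0 ≤ c := mul_nonneg (by linarith) hq0
  have hcε : c ≤ ε / 2 := by rw [hc]; nlinarith
  have hcd : c * d = (1 - ε) * Real.log d := by rw [hc]; field_simp
  have hcc : c ≤ (1 - c) ^ (d - 1) := by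
    have a1 : (1 - c) ^ d ≤ (1 - c) ^ (d - 1) := pow_le_pow_of_le_one (by linarith) (by linarith) (by omega)
    have hp : 0 < 1 - c := by linarith
    have a2 : Real.exp (-(1 - ε / 2) * Real.log d) ≤ (1 - c) ^ d := by
      rw [← Real.exp_log (pow_pos hp d), Real.exp_le_exp, Real.log_pow]
      have b1 := Real.one_sub_inv_le_log_of_pos hp
      have b2 : -(1 - ε / 2) * Real.log d ≤ d * (1 - (1 - c)⁻¹) := by
        have : d * (1 - (1 - c)⁻¹) = -((1 - ε) * Real.log d / (1 - c)) := by
          rw [← hcd]; field_simp; ring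
        rw [this, neg_mul, neg_le_neg_iff, div_le_iff₀ hp]
        have : (1 - ε) ≤ (1 - ε / 2) * (1 - c) := by nlinarith
        nlinarith
      exact b2.trans (mul_le_mul_of_nonneg_left b1 hdp.le)
    have a3 : Real.log d / d ≤ Real.exp (-(1 - ε / 2) * Real.log d) := by
      have : Real.exp (-(1 - ε / 2) * Real.log d) = (d : ℝ) ^ (ε / 2) / d := by
        rw [Real.rpow_def_of_pos hdp]
        nth_rewrite 3 [← Real.exp_log hdp]
        rw [← Real.exp_sub]
        congr 1; ring
      rw [this]
      gcongr
    have a4 : c ≤ Real.log d / d := by rw [hc]; nlinarith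
    linarith
  have hN : 1 ≤ 2 ^ (2 * d) := Nat.one_le_two_pow
  have hP := PP_ge hN hd (by linarith) hcc
  have hPb := PP_bounds hN hd (2 ^ (2 * d))
  refine le_trans ?_ (PP_sum hN hd)
  have hNd : (d : ℝ) / ((2 ^ (2 * d) : ℕ) : ℝ) ≤ ε := by
    have : (d : ℝ) * d ≤ ((2 ^ (2 * d) : ℕ) : ℝ) := by
      have h : d * d ≤ 2 ^ (2 * d) := by
        rw [two_mul, pow_add]
        exact Nat.mul_le_mul Nat.lt_two_pow_self.le Nat.lt_two_pow_self.le
      exact_mod_cast h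
    have hε3 : 1 ≤ ε * d := by rw [div_le_iff₀ hε] at h3; linarith
    rw [div_le_iff₀ (by positivity)]
    nlinarith
  set P := PP (2 ^ (2 * d)) d (2 ^ (2 * d)) with hPdef
  have k1 : c - c ^ 2 / 2 ≤ P - P ^ 2 / 2 := by nlinarith
  have k2 : (1 - ε) * c ≤ c - c ^ 2 / 2 := by nlinarith
  calc (1 - ε) ^ 3 * (Real.log d / d) = (1 - ε) * ((1 - ε) * c) := by rw [hc]; ring
    _ ≤ _ := mul_le_mul (by linarith) (k2.trans k1) (mul_nonneg (by linarith) hc0) (by linarith)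

open Filter in
theorem lower_eventually {ε : ℝ} (hε : 0 < ε) (hε1 : ε < 1) : ∀ᶠ n : ℕ in atTop,
    ∀ β : Measure (FreeGroup (Fin n) → Bool), IsProbabilityMeasure β → IsBernoulliMeasure β →
    ∃ I : Set (FreeGroup (Fin n) → Bool), NullMeasurableSet I β ∧ I ⊆ freePart (FreeGroup (Fin n)) ∧
      IndepIn (freeGroupSchreierAdj n) I ∧ (1 - ε) ^ 3 / 2 * (Real.log n / n) ≤ β.real I := by
  have ht : Tendsto (fun n : ℕ => 2 * n) atTop atTop :=
    tendsto_atTop_mono (fun n => by simp only [id]; omega) tendsto_id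
  filter_upwards [ht.eventually (lower_num hε hε1)] with n ⟨hn, h⟩ β hp hβ
  obtain ⟨I, i1, i2, i3, i4⟩ := exists_indep (n := n) (by omega) (2 * (2 * n)) hβ
  refine ⟨I, i1, i2, i3, ?_⟩
  rw [i4]
  refine le_trans ?_ h
  have hn1 : (1 : ℝ) ≤ n := by exact_mod_cast (by omega : 1 ≤ n)
  have hl : Real.log n ≤ Real.log (2 * n) := Real.log_le_log (by linarith) (by linarith)
  push_cast
  have : (1 - ε) ^ 3 / 2 * (Real.log n / n) = (1 - ε) ^ 3 * (Real.log n / (2 * n)) := by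
    field_simp
  rw [this]
  have : 0 ≤ (1 - ε) ^ 3 := pow_nonneg (by linarith) 3
  gcongr

/-- The `β`-independence number of `G_n` is
`(1/2 + o(1)) (log n) / n`. -/
theorem measurable_independence_number_free_group_asymptotics
    (β : ∀ n : ℕ, Measure (FreeGroup (Fin n) → Bool))
    (hprob : ∀ n, IsProbabilityMeasure (β n))
    (hβ : ∀ n, IsBernoulliMeasure (β n)) :
    Filter.Tendsto (fun n : ℕ =>
        sSup { r : ℝ | ∃ I : Set (FreeGroup (Fin n) → Bool),
            NullMeasurableSet I (β n) ∧ I ⊆ freePart (FreeGroup (Fin n)) ∧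
            IndepIn (freeGroupSchreierAdj n) I ∧ r = ((β n) I).toReal }
          * n / Real.log n)
      Filter.atTop (nhds (1 / 2)) := by
  have hpos : ∀ᶠ n : ℕ in Filter.atTop, (0 : ℝ) < n ∧ 0 < Real.log n := by
    filter_upwards [Filter.eventually_ge_atTop 2] with n hn
    have : (2 : ℝ) ≤ n := by exact_mod_cast hn
    exact ⟨by linarith, Real.log_pos (by linarith)⟩
  refine tendsto_order.2 ⟨fun a ha => ?_, fun a ha => ?_⟩
  · obtain ⟨ε, hε, hε1, hεa⟩ : ∃ ε : ℝ, 0 < ε ∧ ε < 1 ∧ a < (1 - ε) ^ 3 / 2 := by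
      have hc : Filter.Tendsto (fun ε : ℝ => (1 - ε) ^ 3 / 2) (nhdsWithin 0 (Set.Ioi 0)) (nhds ((1 - 0) ^ 3 / 2)) :=
        (Continuous.tendsto (by fun_prop) 0).mono_left nhdsWithin_le_nhds
      have h1 := hc.eventually (lt_mem_nhds (show a < (1 - 0) ^ 3 / 2 by linarith))
      have h2 : ∀ᶠ ε : ℝ in nhdsWithin 0 (Set.Ioi 0), ε ∈ Set.Ioo (0 : ℝ) 1 := Ioo_mem_nhdsGT one_pos
      obtain ⟨ε, x, y⟩ := (h1.and h2).exists
      exact ⟨ε, y.1, y.2, x⟩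
    filter_upwards [lower_eventually hε hε1, hpos] with n hn hp
    obtain ⟨I, i1, i2, i3, i4⟩ := hn (β n) (hprob n) (hβ n)
    refine hεa.trans_le ?_
    rw [le_div_iff₀ hp.2]
    have hle : (β n).real I ≤ sSup { r : ℝ | ∃ I : Set (FreeGroup (Fin n) → Bool),
            NullMeasurableSet I (β n) ∧ I ⊆ freePart (FreeGroup (Fin n)) ∧
            IndepIn (freeGroupSchreierAdj n) I ∧ r = ((β n) I).toReal } := by
      refine le_csSup ⟨1, ?_⟩ ⟨I, i1, i2, i3, rfl⟩
      rintro r ⟨J, _, _, _, rfl⟩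
      have := hprob n
      exact measureReal_le_one
    have h5 := mul_le_mul_of_nonneg_right (i4.trans hle) hp.1.le
    have h6 : (1 - ε) ^ 3 / 2 * (Real.log n / n) * n = (1 - ε) ^ 3 / 2 * Real.log n := by
      have := hp.1.ne'
      field_simp
    linarith
  · have hε : 0 < (a - 1 / 2) / 2 := by linarith
    filter_upwards [upper_eventually hε, hpos] with n hn hp
    rw [div_lt_iff₀ hp.2]
    have hle : sSup { r : ℝ | ∃ I : Set (FreeGroup (Fin n) → Bool),
            NullMeasurableSet I (β n) ∧ I ⊆ freePart (FreeGroup (Fin n)) ∧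
            IndepIn (freeGroupSchreierAdj n) I ∧ r = ((β n) I).toReal } ≤
            (1 / 2 + (a - 1 / 2) / 2) * Real.log n / n := by
      refine csSup_le ⟨0, ∅, by simp, by simp, fun x hx => hx.elim, by simp⟩ ?_
      rintro r ⟨J, j1, j2, j3, rfl⟩
      exact hn (β n) (hprob n) (hβ n) J j1 j2 j3
    have h5 := mul_le_mul_of_nonneg_right hle hp.1.le
    rw [div_mul_cancel₀ _ hp.1.ne'] at h5
    refine h5.trans_lt ?_
    exact mul_lt_mul_of_pos_right (by linarith) hp.2
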